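/- arXiv:1904.01045 — 7 statements merged into one kernel-verified Lean document; each statement's English description precedes it below -/
import Mathlib

section
/- For every integer d ≥ 1 there exist constants η > 0 and α₀ ∈ (0,1), depending only on d, with the following property. For every α ∈ (0,α₀), every z ∈ ℝ^d with ‖z‖ < 1/4, every r ∈ (0,1/4) and every unit vector v ∈ ℝ^d, there exists a C^∞ diffeomorphism T : ℝ^d → ℝ^d such that: (i) T(x) = x for every x outside the open ball ball(z, 3r); (ii) T(x) = x + α·η·r·v for every x ∈ ball(z, 2r); (iii) ‖fderiv ℝ T y − id‖ ≤ α for every y ∈ ℝ^d; and (iv) ‖T(x) − x‖ ≤ r/(100·d²) for every x ∈ ℝ^d. -/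
open Metric

/-- A `C^n` perturbation of the identity by a strict contraction is a `C^n` diffeomorphism. -/
theorem exists_equiv_add_contDiff_symm {E : Type*} [NormedAddCommGroup E] [NormedSpace ℝ E]
    [CompleteSpace E] {g : E → E} {K : NNReal} {n : WithTop ℕ∞} (hK : K < 1)
    (hlip : LipschitzWith K g) (hg : ContDiff ℝ n g) (hn : n ≠ 0) :
    ∃ T : E ≃ E, (∀ x, T x = x + g x) ∧ ContDiff ℝ n T.symm := by
  have happ : ApproximatesLinearOn (fun x => x + g x)
      ((ContinuousLinearEquiv.refl ℝ E : E ≃L[ℝ] E) : E →L[ℝ] E) Set.univ K := by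
    intro x _ y _
    have : x + g x - (y + g y) - (x - y) = g x - g y := by abel
    simpa [this] using hlip.norm_sub_le x y
  have hc : Subsingleton E ∨
      K < ‖((ContinuousLinearEquiv.refl ℝ E).symm : E →L[ℝ] E)‖₊⁻¹ := by
    rcases subsingleton_or_nontrivial E with h | h
    · exact Or.inl h
    · right
      have : ‖((ContinuousLinearEquiv.refl ℝ E).symm : E →L[ℝ] E)‖₊ = 1 :=
        ContinuousLinearMap.nnnorm_id
      simpa [this] using hK
  let e : E ≃ₜ E := happ.toHomeomorph _ hc
  have he : ∀ x, e x = x + g x := fun _ => rfl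
  have hd : ∀ x, ‖-fderiv ℝ g x‖ < 1 := fun x => by
    rw [norm_neg]
    exact (norm_fderiv_le_of_lipschitz ℝ hlip).trans_lt (by exact_mod_cast hK)
  refine ⟨e.toEquiv, he, e.contDiff_symm
    (f₀' := fun x => ContinuousLinearEquiv.ofUnit (Units.oneSub _ (hd x))) (fun x => ?_)
    (contDiff_id.add hg)⟩
  have hL : (ContinuousLinearEquiv.ofUnit (Units.oneSub _ (hd x)) : E →L[ℝ] E) =
      ContinuousLinearMap.id ℝ E + fderiv ℝ g x := by
    ext y
    change (1 - -fderiv ℝ g x) y = _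
    simp
  rw [hL]
  exact (hasFDerivAt_id x).add (hg.differentiable hn x).hasFDerivAt

/-- A translation of `ball z (2 * r)` by a small multiple of `v`, cut off outside `ball z (3 * r)`,
extends to a smooth diffeomorphism close to the identity. -/
theorem exists_equiv_translation_of_ball {E : Type*} [NormedAddCommGroup E] [NormedSpace ℝ E]
    [FiniteDimensional ℝ E] [HasContDiffBump E] {D : ℝ} (hD : 0 < D) :
    ∃ η : ℝ, 0 < η ∧ ∀ α : ℝ, 0 < α → α < 1 → ∀ z : E, ∀ r : ℝ, 0 < r → ∀ v : E, ‖v‖ = 1 →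
      ∃ T : E ≃ E, ContDiff ℝ (⊤ : ℕ∞) T ∧ ContDiff ℝ (⊤ : ℕ∞) T.symm ∧
        (∀ x, x ∉ ball z (3 * r) → T x = x) ∧
        (∀ x ∈ ball z (2 * r), T x = x + (α * η * r) • v) ∧
        (∀ y, ‖fderiv ℝ T y - ContinuousLinearMap.id ℝ E‖ ≤ α) ∧
        (∀ x, ‖T x - x‖ ≤ r / D) := by
  have : CompleteSpace E := FiniteDimensional.complete ℝ E
  let φ : ContDiffBump (0 : E) := ⟨2, 3, by norm_num, by norm_num⟩
  obtain ⟨C, hC⟩ := ContDiff.lipschitzWith_of_hasCompactSupport φ.hasCompactSupport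
    (φ.contDiff (n := (⊤ : ℕ∞))) (by simp)
  have hCD : 0 < (C : ℝ) + D := add_pos_of_nonneg_of_pos C.coe_nonneg hD
  set η : ℝ := 1 / (C + D)
  have hη : 0 < η := by positivity
  have hηC : η * C ≤ 1 := by
    rw [one_div_mul_eq_div, div_le_one hCD]
    linarith
  have hηD : η ≤ 1 / D := one_div_le_one_div_of_le hD (by linarith [C.coe_nonneg])
  refine ⟨η, hη, fun α hα hα₁ z r hr v hv => ?_⟩
  let g : E → E :=
    fun x => (α * η * r * φ (r⁻¹ • (x - z))) • v
  have hg : ContDiff ℝ (⊤ : ℕ∞) g :=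
    (contDiff_const.mul (φ.contDiff.comp (contDiff_const.smul
      (contDiff_id.sub contDiff_const)))).smul contDiff_const
  have hlip : LipschitzWith (NNReal.mk α hα.le) g := by
    refine LipschitzWith.of_dist_le_mul fun x y => ?_
    have h1 := hC.dist_le_mul (r⁻¹ • (x - z)) (r⁻¹ • (y - z))
    rw [Real.dist_eq, dist_eq_norm, ← smul_sub, sub_sub_sub_cancel_right, norm_smul,
      Real.norm_of_nonneg (by positivity)] at h1
    rw [dist_eq_norm, dist_eq_norm, ← sub_smul, norm_smul, hv, mul_one, ← mul_sub, norm_mul,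
      Real.norm_of_nonneg (by positivity), Real.norm_eq_abs, NNReal.coe_mk]
    calc α * η * r * |φ (r⁻¹ • (x - z)) - φ (r⁻¹ • (y - z))|
        ≤ α * η * r * (C * (r⁻¹ * ‖x - y‖)) := by gcongr
      _ = α * (η * C) * ‖x - y‖ := by field_simp
      _ ≤ α * 1 * ‖x - y‖ := by gcongr
      _ = α * ‖x - y‖ := by rw [mul_one]
  have hα1 : (⟨α, hα.le⟩ : NNReal) < 1 := hα₁
  obtain ⟨T, hT, hTs⟩ := exists_equiv_add_contDiff_symm hα1 hlip hg (by simp)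
  have hTg : ⇑T = fun x => x + g x := funext hT
  have hnorm : ∀ x, ‖r⁻¹ • (x - z)‖ = dist x z / r := fun x => by
    rw [norm_smul, Real.norm_of_nonneg (by positivity), dist_eq_norm, inv_mul_eq_div]
  refine ⟨T, hTg ▸ contDiff_id.add hg, hTs, fun x hx => ?_, fun x hx => ?_, fun y => ?_,
    fun x => ?_⟩
  · have : φ (r⁻¹ • (x - z)) = 0 := φ.zero_of_le_dist <| by
      rw [dist_zero_right, hnorm, le_div_iff₀ hr]
      simpa using hx
    simp [hT, g, this]
  · have : φ (r⁻¹ • (x - z)) = 1 := φ.one_of_mem_closedBall <| by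
      rw [mem_closedBall, dist_zero_right, hnorm, div_le_iff₀ hr]
      exact (mem_ball.1 hx).le
    simp [hT, g, this]
  · have h := (hasFDerivAt_id y).add (hg.differentiable (by simp) y).hasFDerivAt
    have h' : fderiv ℝ T y = ContinuousLinearMap.id ℝ _ + fderiv ℝ g y := by
      rw [hTg]
      exact h.fderiv
    rw [h', add_sub_cancel_left]
    exact norm_fderiv_le_of_lipschitz ℝ hlip
  · have h0 : 0 ≤ φ (r⁻¹ • (x - z)) := φ.nonneg
    have h1 : φ (r⁻¹ • (x - z)) ≤ 1 := φ.le_one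
    rw [hT, add_sub_cancel_left, norm_smul, hv, mul_one, Real.norm_of_nonneg (by positivity)]
    calc α * η * r * φ (r⁻¹ • (x - z)) ≤ 1 * (1 / D) * r * 1 := by
          gcongr
      _ = r / D := by ring

theorem elementary_perturbation (d : ℕ) (hd : 1 ≤ d) :
    ∃ η : ℝ, 0 < η ∧ ∃ α₀ : ℝ, 0 < α₀ ∧ α₀ < 1 ∧
      ∀ α : ℝ, 0 < α → α < α₀ →
      ∀ z : EuclideanSpace ℝ (Fin d), ‖z‖ < 1/4 →
      ∀ r : ℝ, 0 < r → r < 1/4 →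
      ∀ v : EuclideanSpace ℝ (Fin d), ‖v‖ = 1 →
      ∃ T : EuclideanSpace ℝ (Fin d) ≃ EuclideanSpace ℝ (Fin d),
        ContDiff ℝ (⊤ : ℕ∞) ⇑T ∧ ContDiff ℝ (⊤ : ℕ∞) ⇑T.symm ∧
        (∀ x, x ∉ ball z (3 * r) → T x = x) ∧
        (∀ x ∈ ball z (2 * r), T x = x + (α * η * r) • v) ∧
        (∀ y, ‖fderiv ℝ (⇑T) y - ContinuousLinearMap.id ℝ (EuclideanSpace ℝ (Fin d))‖ ≤ α) ∧
        (∀ x, ‖T x - x‖ ≤ r / (100 * (d : ℝ) ^ 2)) := by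
  have hD : (0 : ℝ) < 100 * (d : ℝ) ^ 2 := by
    have : (0 : ℝ) < d := by exact_mod_cast hd
    positivity
  obtain ⟨η, hη, h⟩ := exists_equiv_translation_of_ball (E := EuclideanSpace ℝ (Fin d)) hD
  exact ⟨η, hη, 1 / 2, by norm_num, by norm_num, fun α hα hα₀ z _ r hr _ v hv =>
    h α hα (hα₀.trans (by norm_num)) z r hr v hv⟩
end

section
/- For every integer d ≥ 2 there exist constants η > 0 and α₀ ∈ (0,1), depending only on d, with the following property. For every α ∈ (0,α₀), every z ∈ ℝ^d with ‖z‖ < 1/4, every r ∈ (0,1/4) and every unit vector v ∈ ℝ^d, there exists a C^∞ diffeomorphism T : ℝ^d → ℝ^d that preserves Lebesgue measure (MeasurePreserving T volume volume) and satisfies: (i) T(x) = x for every x outside ball(z, 3r); (ii) T(x) = x + α·η·r·v for every x ∈ ball(z, 2r); (iii) ‖fderiv ℝ T y − id‖ ≤ α for every y; and (iv) ‖T(x) − x‖ ≤ r/(100·d²) for every x. -/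
open Metric MeasureTheory

section Shear

variable {E : Type*} [NormedAddCommGroup E] [NormedSpace ℝ E]

/-- The derivative of `x ↦ x + a x • w`, where `φ` is the derivative of `a`. -/
lemma hasFDerivAt_add_smul_const {a : E → ℝ} {φ : E →L[ℝ] ℝ} {x : E}
    (ha : HasFDerivAt a φ x) (w : E) :
    HasFDerivAt (fun x => x + a x • w) (ContinuousLinearMap.id ℝ E + φ.smulRight w) x :=
  (hasFDerivAt_id x).add (ha.smul_const w)

lemma det_id_add_smulRight [FiniteDimensional ℝ E] (φ : E →L[ℝ] ℝ) (w : E) :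
    (ContinuousLinearMap.id ℝ E + φ.smulRight w).det = 1 + φ w := by
  have h : ((ContinuousLinearMap.id ℝ E + φ.smulRight w : E →L[ℝ] E) : E →ₗ[ℝ] E)
      = LinearMap.transvection (φ : E →ₗ[ℝ] ℝ) w := by
    ext x
    simp [LinearMap.transvection.apply]
  rw [ContinuousLinearMap.det, h, LinearMap.transvection.det]
  rfl

/-- If `a` is smooth and `k`-Lipschitz with `k < 1` and `w` is a unit vector, then
`x ↦ x + a x • w` is a diffeomorphism. -/
lemma exists_homeomorph_add_smul_const [FiniteDimensional ℝ E] {a : E → ℝ}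
    (ha : ContDiff ℝ (⊤ : ℕ∞) a) {k : NNReal} (hk : k < 1) (hak : LipschitzWith k a)
    {w : E} (hw : ‖w‖ = 1) :
    ∃ F : E ≃ₜ E, (∀ x, F x = x + a x • w) ∧ ContDiff ℝ (⊤ : ℕ∞) F.symm := by
  have : CompleteSpace E := FiniteDimensional.complete ℝ E
  have : Nontrivial E := ⟨w, 0, by rintro rfl; simp at hw⟩
  set f : E → E := fun x => x + a x • w with hf
  have happ : ApproximatesLinearOn f
      ((ContinuousLinearEquiv.refl ℝ E : E ≃L[ℝ] E) : E →L[ℝ] E) Set.univ k := by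
    intro x _ y _
    have : f x - f y - ((ContinuousLinearEquiv.refl ℝ E : E ≃L[ℝ] E) : E →L[ℝ] E) (x - y)
        = (a x - a y) • w := by
      simp only [hf, ContinuousLinearEquiv.coe_refl, ContinuousLinearMap.coe_id', id, sub_smul]
      abel
    rw [this, norm_smul, hw, mul_one, ← dist_eq_norm, ← dist_eq_norm]
    exact hak.dist_le_mul x y
  have hc : Subsingleton E ∨
      k < ‖((ContinuousLinearEquiv.refl ℝ E : E ≃L[ℝ] E).symm : E →L[ℝ] E)‖₊⁻¹ := by
    right
    simpa using hk
  let F := happ.toHomeomorph f hc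
  have hFf : ⇑F = f := rfl
  refine ⟨F, fun x => rfl, ?_⟩
  have hd : ∀ x, HasFDerivAt f (ContinuousLinearMap.id ℝ E + (fderiv ℝ a x).smulRight w) x :=
    fun x => hasFDerivAt_add_smul_const
      ((ha.differentiable (by simp)).differentiableAt.hasFDerivAt) w
  have hdet : ∀ x, (ContinuousLinearMap.id ℝ E + (fderiv ℝ a x).smulRight w).det ≠ 0 := by
    intro x
    rw [det_id_add_smulRight]
    have h1 : |fderiv ℝ a x w| ≤ k := by
      calc |fderiv ℝ a x w| ≤ ‖fderiv ℝ a x‖ * ‖w‖ := (fderiv ℝ a x).le_opNorm w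
        _ ≤ k := by rw [hw, mul_one]; exact norm_fderiv_le_of_lipschitz ℝ hak
    have h2 : (k : ℝ) < 1 := by exact_mod_cast hk
    have := (abs_le.1 h1).1
    intro h
    linarith
  refine F.contDiff_symm
    (f₀' := fun x => ContinuousLinearMap.toContinuousLinearEquivOfDetNeZero _ (hdet x)) ?_ ?_
  · intro x
    rw [hFf]
    simpa using hd x
  · rw [hFf]
    fun_prop

/-- If `a`, `b` are smooth with small Lipschitz constants and `∂_w a = ∂_v b`, the map sending
`y + a y • w` to `y + b y • v` is a volume-preserving diffeomorphism close to the identity. -/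
lemma exists_measurePreserving_of_fderiv_eq [FiniteDimensional ℝ E] [MeasurableSpace E]
    [BorelSpace E] (μ : Measure E) [μ.IsAddHaarMeasure] {a b : E → ℝ}
    (ha : ContDiff ℝ (⊤ : ℕ∞) a) (hb : ContDiff ℝ (⊤ : ℕ∞) b) {k : NNReal} (hk : k ≤ 1 / 2)
    (hak : LipschitzWith k a) (hbk : LipschitzWith k b) {v w : E} (hv : ‖v‖ = 1) (hw : ‖w‖ = 1)
    (hab : ∀ x, fderiv ℝ a x w = fderiv ℝ b x v) :
    ∃ T : E ≃ E, ContDiff ℝ (⊤ : ℕ∞) T ∧ ContDiff ℝ (⊤ : ℕ∞) T.symm ∧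
      MeasurePreserving T μ μ ∧ (∀ y, T (y + a y • w) = y + b y • v) ∧
      (∀ x, ∃ y, y + a y • w = x) ∧
      (∀ x, ‖fderiv ℝ T x - ContinuousLinearMap.id ℝ E‖ ≤ 4 * k) := by
  have hk1 : k < 1 := hk.trans_lt (by rw [div_lt_one (by norm_num)]; norm_num)
  have hkR : (k : ℝ) ≤ 1 / 2 := by exact_mod_cast hk
  obtain ⟨F, hF, hFs⟩ := exists_homeomorph_add_smul_const ha hk1 hak hw
  obtain ⟨G, hG, hGs⟩ := exists_homeomorph_add_smul_const hb hk1 hbk hv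
  have hFc : ContDiff ℝ (⊤ : ℕ∞) F := by
    rw [show ⇑F = fun x => x + a x • w from funext hF]; fun_prop
  have hGc : ContDiff ℝ (⊤ : ℕ∞) G := by
    rw [show ⇑G = fun x => x + b x • v from funext hG]; fun_prop
  have hT : ContDiff ℝ (⊤ : ℕ∞) (F.symm.trans G) := hGc.comp hFs
  refine ⟨(F.symm.trans G).toEquiv, hT, hFc.comp hGs, ?_, ?_, ?_, ?_⟩
  · have hm : Measurable (F.symm.trans G).toEquiv := (F.symm.trans G).continuous.measurable
    refine ⟨hm, ?_⟩
    ext B hB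
    rw [Measure.map_apply hm hB]
    have hA : MeasurableSet (G ⁻¹' B) := G.continuous.measurable hB
    have h1 : ⇑(F.symm.trans G).toEquiv ⁻¹' B = F '' (G ⁻¹' B) := by
      ext x
      simp [F.image_eq_preimage_symm]
    have h2 : B = G '' (G ⁻¹' B) := (G.surjective.image_preimage B).symm
    rw [h1]
    conv_rhs => rw [h2]
    have dF : ∀ x ∈ G ⁻¹' B, HasFDerivWithinAt F
        (ContinuousLinearMap.id ℝ E + (fderiv ℝ a x).smulRight w) (G ⁻¹' B) x := by
      intro x _
      rw [show ⇑F = fun x => x + a x • w from funext hF]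
      exact (hasFDerivAt_add_smul_const
        ((ha.differentiable (by simp)).differentiableAt.hasFDerivAt) w).hasFDerivWithinAt
    have dG : ∀ x ∈ G ⁻¹' B, HasFDerivWithinAt G
        (ContinuousLinearMap.id ℝ E + (fderiv ℝ b x).smulRight v) (G ⁻¹' B) x := by
      intro x _
      rw [show ⇑G = fun x => x + b x • v from funext hG]
      exact (hasFDerivAt_add_smul_const
        ((hb.differentiable (by simp)).differentiableAt.hasFDerivAt) v).hasFDerivWithinAt
    rw [← lintegral_abs_det_fderiv_eq_addHaar_image μ hA dF F.injective.injOn,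
      ← lintegral_abs_det_fderiv_eq_addHaar_image μ hA dG G.injective.injOn]
    simp only [det_id_add_smulRight, hab]
  · intro y
    rw [← hF, ← hG]
    simp
  · intro x
    exact ⟨F.symm x, by rw [← hF, F.apply_symm_apply]⟩
  · intro x
    have hlip : LipschitzWith (4 * k) (fun x => (F.symm.trans G) x - x) := by
      refine LipschitzWith.of_dist_le_mul fun x y => ?_
      obtain ⟨p, rfl⟩ := F.surjective x
      obtain ⟨q, rfl⟩ := F.surjective y
      simp only [Homeomorph.trans_apply, Homeomorph.symm_apply_apply]
      simp only [hF, hG]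
      have e1 : p + b p • v - (p + a p • w) - (q + b q • v - (q + a q • w))
          = (b p - b q) • v - (a p - a q) • w := by
        simp only [sub_smul]; abel
      have e2 : p - q = p + a p • w - (q + a q • w) - (a p - a q) • w := by
        simp only [sub_smul]; abel
      have na : ‖(a p - a q) • w‖ ≤ k * ‖p - q‖ := by
        rw [norm_smul, hw, mul_one, ← dist_eq_norm, ← dist_eq_norm]
        exact hak.dist_le_mul p q
      have nb : ‖(b p - b q) • v‖ ≤ k * ‖p - q‖ := by
        rw [norm_smul, hv, mul_one, ← dist_eq_norm, ← dist_eq_norm]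
        exact hbk.dist_le_mul p q
      rw [dist_eq_norm, dist_eq_norm, e1]
      have n1 := norm_sub_le ((b p - b q) • v) ((a p - a q) • w)
      have n2 := norm_sub_le (p + a p • w - (q + a q • w)) ((a p - a q) • w)
      rw [← e2] at n2
      have hk0 : (0 : ℝ) ≤ k := k.2
      have n3 : ‖p - q‖ ≤ 2 * ‖p + a p • w - (q + a q • w)‖ := by
        nlinarith [norm_nonneg (p - q)]
      push_cast
      nlinarith [norm_nonneg (p - q)]
    have hd := ((hT.differentiable (by simp)).differentiableAt (x := x)).hasFDerivAt.sub
      (hasFDerivAt_id x)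
    have := norm_fderiv_le_of_lipschitz ℝ (x₀ := x) hlip
    have e : fderiv ℝ (fun x => (F.symm.trans G) x - x) x
      = fderiv ℝ (F.symm.trans G) x - ContinuousLinearMap.id ℝ E := hd.fderiv
    rw [e] at this
    exact_mod_cast this

end Shear

lemma exists_norm_eq_one_inner_eq_zero {E : Type*} [NormedAddCommGroup E] [InnerProductSpace ℝ E]
    [FiniteDimensional ℝ E] (h : 2 ≤ Module.finrank ℝ E) (v : E) :
    ∃ w : E, ‖w‖ = 1 ∧ inner ℝ v w = 0 := by
  have h1 : Module.finrank ℝ (ℝ ∙ v) ≤ 1 := by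
    simpa using finrank_span_le_card (R := ℝ) ({v} : Set E)
  have h2 := (ℝ ∙ v).finrank_add_finrank_orthogonal
  have h3 : (ℝ ∙ v)ᗮ ≠ ⊥ := by
    intro h0
    rw [h0, finrank_bot] at h2
    omega
  obtain ⟨u, hu, hu0⟩ := Submodule.exists_mem_ne_zero_of_ne_bot h3
  refine ⟨‖u‖⁻¹ • u, by simp [norm_smul, hu0], ?_⟩
  rw [inner_smul_right, Submodule.mem_orthogonal_singleton_iff_inner_right.1 hu, mul_zero]

lemma exists_norm_fderiv_le {E F : Type*} [NormedAddCommGroup E] [NormedSpace ℝ E]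
    [NormedAddCommGroup F] [NormedSpace ℝ F] {f : E → F} (hf : ContDiff ℝ (⊤ : ℕ∞) f)
    (hs : HasCompactSupport f) : ∃ K : ℝ, ∀ x, ‖fderiv ℝ f x‖ ≤ K := by
  have h : HasCompactSupport (fderiv ℝ f) := hs.fderiv (𝕜 := ℝ)
  exact h.exists_bound_of_continuous (hf.continuous_fderiv (by simp))

/-- A compactly supported smooth vector field equal to the identity on the ball of radius `2`,
with bounds on its first two derivatives. -/
lemma exists_contDiff_cutoff_id (E : Type*) [NormedAddCommGroup E] [InnerProductSpace ℝ E]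
    [FiniteDimensional ℝ E] :
    ∃ Φ : E → E, ContDiff ℝ (⊤ : ℕ∞) Φ ∧
      (∀ x ∈ ball (0 : E) 2, fderiv ℝ Φ x = ContinuousLinearMap.id ℝ E) ∧
      (∀ x ∉ ball (0 : E) 3, fderiv ℝ Φ x = 0) ∧
      ∃ K : ℝ, 1 ≤ K ∧ (∀ x, ‖fderiv ℝ Φ x‖ ≤ K) ∧ ∀ x, ‖fderiv ℝ (fderiv ℝ Φ) x‖ ≤ K := by
  obtain ⟨χ, hin, hout⟩ : ∃ χ : ContDiffBump (0 : E), χ.rIn = 2 ∧ χ.rOut = 5 / 2 :=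
    ⟨⟨2, 5 / 2, by norm_num, by norm_num⟩, rfl, rfl⟩
  have hc : ContDiff ℝ (⊤ : ℕ∞) (fun x => χ x • x) := χ.contDiff.smul contDiff_id
  have hs : HasCompactSupport (fun x => χ x • x) := χ.hasCompactSupport.smul_right
  have hc1 : ContDiff ℝ (⊤ : ℕ∞) (fderiv ℝ fun x => χ x • x) := hc.fderiv_right (by simp)
  have hs1 : HasCompactSupport (fderiv ℝ fun x => χ x • x) := hs.fderiv (𝕜 := ℝ)
  obtain ⟨K₁, hK₁⟩ := exists_norm_fderiv_le hc hs
  obtain ⟨K₂, hK₂⟩ := exists_norm_fderiv_le hc1 hs1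
  refine ⟨fun x => χ x • x, hc, fun x hx => ?_, fun x hx => ?_, max 1 (max K₁ K₂),
    le_max_left _ _, fun x => (hK₁ x).trans ((le_max_left _ _).trans (le_max_right _ _)),
    fun x => (hK₂ x).trans ((le_max_right _ _).trans (le_max_right _ _))⟩
  · have : (fun x => χ x • x) =ᶠ[nhds x] id := by
      filter_upwards [isOpen_ball.mem_nhds hx] with y hy
      rw [χ.one_of_mem_closedBall (hin ▸ ball_subset_closedBall hy), one_smul, id]
    rw [this.fderiv_eq, fderiv_id]
  · have : (fun x => χ x • x) =ᶠ[nhds x] fun _ => 0 := by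
      have hx' : x ∈ (closedBall (0 : E) (5 / 2))ᶜ := fun h =>
        hx (closedBall_subset_ball (by norm_num) h)
      filter_upwards [isClosed_closedBall.isOpen_compl.mem_nhds hx'] with y hy
      have hy' : 5 / 2 ≤ dist y 0 := (not_le.1 fun h => hy (mem_closedBall.2 h)).le
      rw [χ.zero_of_le_dist (hout ▸ hy'), zero_smul]
    rw [this.fderiv_eq, fderiv_fun_const, Pi.zero_apply]

section Component

variable {E : Type*} [NormedAddCommGroup E] [InnerProductSpace ℝ E] {Φ : E → E}

/-- The function `x ↦ c r ⟪u, DΦ((x - z) / r) p⟫`. -/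
noncomputable def rescaledComponent (Φ : E → E) (c r : ℝ) (z p u : E) (x : E) : ℝ :=
  c * r * inner ℝ u (fderiv ℝ Φ (r⁻¹ • (x - z)) p)

lemma contDiff_rescaledComponent (hΦ : ContDiff ℝ (⊤ : ℕ∞) Φ) (c r : ℝ) (z p u : E) :
    ContDiff ℝ (⊤ : ℕ∞) (rescaledComponent Φ c r z p u) := by
  have h : ContDiff ℝ (⊤ : ℕ∞) (fderiv ℝ Φ) := hΦ.fderiv_right (by simp)
  have h1 : ContDiff ℝ (⊤ : ℕ∞) fun x : E => fderiv ℝ Φ (r⁻¹ • (x - z)) :=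
    h.comp (by fun_prop)
  exact contDiff_const.mul (contDiff_const.inner ℝ (h1.clm_apply contDiff_const))

lemma fderiv_rescaledComponent (hΦ : ContDiff ℝ (⊤ : ℕ∞) Φ) (c : ℝ) {r : ℝ} (hr : r ≠ 0)
    (z p u x h : E) :
    fderiv ℝ (rescaledComponent Φ c r z p u) x h =
      c * inner ℝ u (fderiv ℝ (fderiv ℝ Φ) (r⁻¹ • (x - z)) h p) := by
  have hc : ContDiff ℝ (⊤ : ℕ∞) (fderiv ℝ Φ) := hΦ.fderiv_right (by simp)
  have hl : HasFDerivAt (fun x : E => r⁻¹ • (x - z)) (r⁻¹ • ContinuousLinearMap.id ℝ E) x :=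
    ((hasFDerivAt_id x).sub_const z).const_smul r⁻¹
  have h1 := ((hc.differentiable (by simp)).differentiableAt
    (x := r⁻¹ • (x - z))).hasFDerivAt.comp x hl
  have h2 := (h1.clm_apply (hasFDerivAt_const p x))
  have h3 := (((innerSL ℝ u).hasFDerivAt (x := _)).comp x h2).const_mul (c * r)
  have h4 : HasFDerivAt (rescaledComponent Φ c r z p u) _ x := h3
  rw [h4.fderiv]
  simp
  field_simp

lemma abs_rescaledComponent_le {K : ℝ} (hK : ∀ x, ‖fderiv ℝ Φ x‖ ≤ K) {c r : ℝ} (hc : 0 ≤ c)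
    (hr : 0 ≤ r) {p u : E} (hp : ‖p‖ = 1) (hu : ‖u‖ = 1) (z x : E) :
    |rescaledComponent Φ c r z p u x| ≤ c * r * K := by
  rw [rescaledComponent, abs_mul, abs_of_nonneg (mul_nonneg hc hr)]
  gcongr
  calc _ ≤ ‖u‖ * ‖fderiv ℝ Φ (r⁻¹ • (x - z)) p‖ := abs_real_inner_le_norm _ _
    _ ≤ ‖u‖ * (‖fderiv ℝ Φ (r⁻¹ • (x - z))‖ * ‖p‖) := by
      gcongr; exact ContinuousLinearMap.le_opNorm _ _
    _ ≤ K := by rw [hp, hu, mul_one, one_mul]; exact hK _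

lemma lipschitzWith_rescaledComponent (hΦ : ContDiff ℝ (⊤ : ℕ∞) Φ) {K : ℝ}
    (hK : ∀ x, ‖fderiv ℝ (fderiv ℝ Φ) x‖ ≤ K) {c r : ℝ} (hc : 0 ≤ c) (hr : r ≠ 0) {p u : E}
    (hp : ‖p‖ = 1) (hu : ‖u‖ = 1) (z : E) {k : NNReal} (hk : c * K ≤ k) :
    LipschitzWith k (rescaledComponent Φ c r z p u) := by
  refine lipschitzWith_of_nnnorm_fderiv_le
    ((contDiff_rescaledComponent hΦ c r z p u).differentiable (by simp)) fun x => ?_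
  rw [← NNReal.coe_le_coe, coe_nnnorm]
  refine ContinuousLinearMap.opNorm_le_bound _ k.2 fun h => ?_
  rw [fderiv_rescaledComponent hΦ c hr, norm_mul, Real.norm_of_nonneg hc]
  calc _ ≤ c * (‖u‖ * ‖fderiv ℝ (fderiv ℝ Φ) (r⁻¹ • (x - z)) h p‖) := by
        gcongr; exact norm_inner_le_norm _ _
    _ ≤ c * (‖u‖ * (‖fderiv ℝ (fderiv ℝ Φ) (r⁻¹ • (x - z))‖ * ‖h‖ * ‖p‖)) := by
        gcongr; exact ContinuousLinearMap.le_opNorm₂ _ _ _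
    _ ≤ c * (‖u‖ * (K * ‖h‖ * ‖p‖)) := by gcongr; exact hK _
    _ = c * K * ‖h‖ := by rw [hp, hu]; ring
    _ ≤ k * ‖h‖ := by gcongr

lemma fderiv_rescaledComponent_comm (hΦ : ContDiff ℝ (⊤ : ℕ∞) Φ) (c : ℝ) {r : ℝ} (hr : r ≠ 0)
    (z p q u x : E) :
    fderiv ℝ (rescaledComponent Φ c r z p u) x q =
      fderiv ℝ (rescaledComponent Φ c r z q u) x p := by
  rw [fderiv_rescaledComponent hΦ c hr, fderiv_rescaledComponent hΦ c hr]
  have hs : IsSymmSndFDerivAt ℝ Φ (r⁻¹ • (x - z)) :=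
    hΦ.contDiffAt.isSymmSndFDerivAt (by
      simpa using (mod_cast le_top : ((2 : ℕ∞) : WithTop ℕ∞) ≤ ((⊤ : ℕ∞) : WithTop ℕ∞)))
  rw [hs.eq q p]

end Component

theorem elementary_perturbation_volume_preserving (d : ℕ) (hd : 2 ≤ d) :
    ∃ η : ℝ, 0 < η ∧ ∃ α₀ : ℝ, 0 < α₀ ∧ α₀ < 1 ∧
      ∀ α : ℝ, 0 < α → α < α₀ →
      ∀ z : EuclideanSpace ℝ (Fin d), ‖z‖ < 1/4 →
      ∀ r : ℝ, 0 < r → r < 1/4 →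
      ∀ v : EuclideanSpace ℝ (Fin d), ‖v‖ = 1 →
      ∃ T : EuclideanSpace ℝ (Fin d) ≃ EuclideanSpace ℝ (Fin d),
        ContDiff ℝ (⊤ : ℕ∞) ⇑T ∧ ContDiff ℝ (⊤ : ℕ∞) ⇑T.symm ∧
        MeasurePreserving (⇑T) volume volume ∧
        (∀ x, x ∉ ball z (3 * r) → T x = x) ∧
        (∀ x ∈ ball z (2 * r), T x = x + (α * η * r) • v) ∧
        (∀ y, ‖fderiv ℝ (⇑T) y - ContinuousLinearMap.id ℝ (EuclideanSpace ℝ (Fin d))‖ ≤ α) ∧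
        (∀ x, ‖T x - x‖ ≤ r / (100 * (d : ℝ) ^ 2)) := by
  obtain ⟨Φ, hΦ, hΦ2, hΦ3, K, hK1, hK, hK'⟩ :=
    exists_contDiff_cutoff_id (EuclideanSpace ℝ (Fin d))
  have hd1 : (1 : ℝ) ≤ d := by exact_mod_cast (by omega : 1 ≤ d)
  have hD : (1 : ℝ) ≤ 100 * (d : ℝ) ^ 2 := by nlinarith
  have hK0 : 0 < K := by linarith
  set D : ℝ := 100 * (d : ℝ) ^ 2
  have hD0 : 0 < D := by linarith
  refine ⟨(4 * K * D)⁻¹, by positivity, 1 / 2, by norm_num, by norm_num, ?_⟩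
  intro α hα hα2 z _ r hr _ v hv
  set c : ℝ := α * (4 * K * D)⁻¹ with hc
  have hc0 : 0 < c := by positivity
  have hcK : c * K = α / (4 * D) := by rw [hc]; field_simp
  have hcKα : c * K ≤ α / 4 := by
    rw [hcK]
    gcongr
    linarith
  obtain ⟨w, hw, hvw⟩ := exists_norm_eq_one_inner_eq_zero (by simpa using hd) v
  let k : NNReal := ⟨α / 4, by positivity⟩
  have hkα : (k : ℝ) = α / 4 := rfl
  have hk : k ≤ 1 / 2 := by
    rw [← NNReal.coe_le_coe, hkα]
    push_cast
    linarith
  obtain ⟨T, hT, hTs, hTm, hTF, hsurj, hTd⟩ := exists_measurePreserving_of_fderiv_eq volume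
    (contDiff_rescaledComponent hΦ c r z v w) (contDiff_rescaledComponent hΦ c r z w w) hk
    (lipschitzWith_rescaledComponent hΦ hK' hc0.le hr.ne' hv hw z (hkα ▸ hcKα))
    (lipschitzWith_rescaledComponent hΦ hK' hc0.le hr.ne' hw hw z (hkα ▸ hcKα)) hv hw
    (fun x => fderiv_rescaledComponent_comm hΦ c hr.ne' z v w w x)
  have hball : ∀ (s : ℝ) (x : EuclideanSpace ℝ (Fin d)),
      r⁻¹ • (x - z) ∈ ball 0 s ↔ x ∈ ball z (s * r) := by
    intro s x
    rw [mem_ball_zero_iff, norm_smul, norm_inv, Real.norm_of_nonneg hr.le, mem_ball_iff_norm,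
      inv_mul_lt_iff₀ hr, mul_comm]
  refine ⟨T, hT, hTs, hTm, ?_, ?_, ?_, ?_⟩
  · intro x hx
    have h := hTF x
    have h0 := hΦ3 _ (fun h => hx ((hball 3 x).1 h))
    simpa [rescaledComponent, h0] using h
  · intro x hx
    have h := hTF x
    have h0 := hΦ2 _ ((hball 2 x).2 hx)
    simpa [rescaledComponent, h0, real_inner_comm, hvw, hw] using h
  · intro y
    have := hTd y
    rw [hkα] at this
    linarith
  · intro x
    obtain ⟨y, rfl⟩ := hsurj x
    rw [hTF]
    have ha := abs_rescaledComponent_le hK hc0.le hr.le hv hw z y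
    have hb := abs_rescaledComponent_le hK hc0.le hr.le hw hw z y
    rw [add_sub_add_left_eq_sub]
    refine (norm_sub_le _ _).trans ?_
    rw [norm_smul, norm_smul, hv, hw, mul_one, mul_one, Real.norm_eq_abs, Real.norm_eq_abs]
    have h1 : c * r * K = r / D * (α / 4) := by
      rw [mul_right_comm, hcK]; field_simp
    have h2 : 0 < r / D := by positivity
    rw [h1] at ha hb
    nlinarith
end

section
/- For every integer n ≥ 1 there exist constants η > 0 and α₀ ∈ (0,1), depending only on n, with the following property. For every α ∈ (0,α₀), every z ∈ ℝ^{2n} with ‖z‖ < 1/4, every r ∈ (0,1/4) and every unit vector v ∈ ℝ^{2n}, there exists a C^∞ diffeomorphism T : ℝ^{2n} → ℝ^{2n} such that: (i) T(x) = x for every x outside ball(z, 3r); (ii) T(x) = x + α·η·r·v for every x ∈ ball(z, 2r); (iii) ‖fderiv ℝ T y − id‖ ≤ α for every y; (iv) ‖T(x) − x‖ ≤ r/(100·(2n)²) for every x; and (v) T is symplectic: for every x and all u, w ∈ ℝ^{2n}, ω(fderiv ℝ T x u, fderiv ℝ T x w) = ω(u, w). -/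
open Metric

open scoped RealInnerProductSpace

/-- `ℝ^{2n}` identified with `(Fin n → ℝ) × (Fin n → ℝ)` with the Euclidean norm. -/
abbrev SympSpace (n : ℕ) :=
  WithLp 2 (EuclideanSpace ℝ (Fin n) × EuclideanSpace ℝ (Fin n))

/-- The standard symplectic form `ω((p,q),(p',q')) = ⟪p,q'⟫ − ⟪q,p'⟫`. -/
noncomputable def stdSymplecticForm (n : ℕ) (u w : SympSpace n) : ℝ :=
  ⟪(WithLp.equiv 2 _ u).1, (WithLp.equiv 2 _ w).2⟫ -
    ⟪(WithLp.equiv 2 _ u).2, (WithLp.equiv 2 _ w).1⟫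

section NearIdentity

variable {E : Type*} [NormedAddCommGroup E] [NormedSpace ℝ E] [CompleteSpace E]

/-- If `A` has norm less than one, then `1 + A` is invertible. -/
theorem ContinuousLinearMap.isInvertible_one_add_of_norm_lt_one {A : E →L[ℝ] E} (hA : ‖A‖ < 1) :
    (1 + A : E →L[ℝ] E).IsInvertible := by
  have h : IsUnit (1 - -A : E →L[ℝ] E) := isUnit_one_sub_of_norm_lt_one (by simpa using hA)
  rw [sub_neg_eq_add] at h
  obtain ⟨B, hB⟩ := h
  exact ⟨ContinuousLinearEquiv.unitsEquiv ℝ E B, hB⟩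

/-- A smooth perturbation of the identity whose derivative has norm at most `1 / 2` is a smooth
diffeomorphism. -/
theorem exists_equiv_id_add_of_norm_fderiv_le {Y : E → E} (hY : ContDiff ℝ (⊤ : ℕ∞) Y)
    (hY' : ∀ x, ‖fderiv ℝ Y x‖ ≤ 1 / 2) :
    ∃ e : E ≃ E, (∀ x, e x = x + Y x) ∧ ContDiff ℝ (⊤ : ℕ∞) ⇑e.symm := by
  have hd : Differentiable ℝ Y := hY.differentiable (by simp)
  have hlip : LipschitzWith (1 / 2) Y := lipschitzWith_of_nnnorm_fderiv_le hd fun x ↦ by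
    rw [← NNReal.coe_le_coe]
    simpa using hY' x
  have happrox : ApproximatesLinearOn (fun x ↦ x + Y x)
      ((ContinuousLinearEquiv.refl ℝ E : E ≃L[ℝ] E) : E →L[ℝ] E) Set.univ (1 / 2) := by
    rw [ApproximatesLinearOn.approximatesLinearOn_iff_lipschitzOnWith]
    convert hlip.lipschitzOnWith (s := Set.univ) using 1
    ext x
    simp
  have hc : Subsingleton E ∨ (1 / 2 : NNReal) <
      ‖((ContinuousLinearEquiv.refl ℝ E).symm : E →L[ℝ] E)‖₊⁻¹ := by
    rcases subsingleton_or_nontrivial E with h | h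
    · exact Or.inl h
    · right
      have : ‖((ContinuousLinearEquiv.refl ℝ E).symm : E →L[ℝ] E)‖₊ = 1 := by
        ext
        exact ContinuousLinearMap.norm_id
      rw [this, inv_one]
      exact NNReal.half_lt_self one_ne_zero
  let e : E ≃ₜ E := happrox.toHomeomorph _ hc
  have he : ∀ x, e x = x + Y x := fun x ↦ rfl
  have hinv : ∀ x, (1 + fderiv ℝ Y x : E →L[ℝ] E).IsInvertible := fun x ↦
    ContinuousLinearMap.isInvertible_one_add_of_norm_lt_one (by linarith [hY' x])
  choose f' hf' using hinv
  refine ⟨e.toEquiv, he, e.contDiff_symm (f₀' := f') (fun x ↦ ?_) (contDiff_id.add hY)⟩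
  rw [hf']
  exact (hasFDerivAt_id x).add (hd x).hasFDerivAt

end NearIdentity

section Cayley

variable {E : Type*} [NormedAddCommGroup E] [NormedSpace ℝ E] [CompleteSpace E]

/-- The implicit midpoint map of the vector field `2 • Y`: it sends `m - Y m` to `m + Y m`. If the
derivatives of `Y` are small and infinitesimally preserve the alternating form `Ω`, it is a smooth
diffeomorphism preserving `Ω`. -/
theorem exists_midpoint_diffeomorphism {Y : E → E} (hY : ContDiff ℝ (⊤ : ℕ∞) Y) {δ : ℝ}
    (hδ : δ ≤ 1 / 2) (hY' : ∀ x, ‖fderiv ℝ Y x‖ ≤ δ) (Ω : E →L[ℝ] E →L[ℝ] ℝ)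
    (hΩ : ∀ x u w, Ω (fderiv ℝ Y x u) w + Ω u (fderiv ℝ Y x w) = 0) :
    ∃ T : E ≃ E, ContDiff ℝ (⊤ : ℕ∞) ⇑T ∧ ContDiff ℝ (⊤ : ℕ∞) ⇑T.symm ∧
      (∀ m, T (m - Y m) = m + Y m) ∧ (∀ x, ∃ m, x = m - Y m) ∧
      (∀ x, ‖fderiv ℝ T x - ContinuousLinearMap.id ℝ E‖ ≤ 4 * δ) ∧
      (∀ x u w, Ω (fderiv ℝ T x u) (fderiv ℝ T x w) = Ω u w) := by
  have hd : Differentiable ℝ Y := hY.differentiable (by simp)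
  obtain ⟨f, hf, hf'⟩ := exists_equiv_id_add_of_norm_fderiv_le hY fun x ↦ (hY' x).trans hδ
  obtain ⟨g, hg, hg'⟩ := exists_equiv_id_add_of_norm_fderiv_le (Y := -Y) hY.neg fun x ↦ by
    rw [fderiv_neg, norm_neg]
    exact (hY' x).trans hδ
  have hgY : ∀ m, g m = m - Y m := fun m ↦ by simp [hg, sub_eq_add_neg]
  have hfsm : ContDiff ℝ (⊤ : ℕ∞) f := by
    rw [funext hf]
    exact contDiff_id.add hY
  have hgsm : ContDiff ℝ (⊤ : ℕ∞) g := by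
    rw [funext hgY]
    exact contDiff_id.sub hY
  have hT : ∀ m, (g.symm.trans f) (m - Y m) = m + Y m := fun m ↦ by
    rw [← hgY, Equiv.trans_apply, Equiv.symm_apply_apply, hf]
  have hex : ∀ x, ∃ m, x = m - Y m := fun x ↦ ⟨g.symm x, by rw [← hgY, Equiv.apply_symm_apply]⟩
  have hTsm : ContDiff ℝ (⊤ : ℕ∞) (g.symm.trans f) := hfsm.comp hg'
  have hderiv : ∀ m, fderiv ℝ (g.symm.trans f) (m - Y m) ∘L (1 - fderiv ℝ Y m) =
      1 + fderiv ℝ Y m := fun m ↦ by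
    have h1 : HasFDerivAt (fun m ↦ m - Y m) (1 - fderiv ℝ Y m) m :=
      (hasFDerivAt_id m).sub (hd m).hasFDerivAt
    have h2 := ((hTsm.differentiable (by simp)) (m - Y m)).hasFDerivAt.comp m h1
    have h3 : HasFDerivAt (fun m ↦ m + Y m) (1 + fderiv ℝ Y m) m :=
      (hasFDerivAt_id m).add (hd m).hasFDerivAt
    exact h2.unique (h3.congr_of_eventuallyEq (.of_forall hT))
  refine ⟨g.symm.trans f, hTsm, hgsm.comp hf', hT, hex, fun x ↦ ?_, fun x u w ↦ ?_⟩
  · obtain ⟨m, rfl⟩ := hex x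
    have hm := hderiv m
    have hA := hY' m
    set A := fderiv ℝ Y m
    set B := fderiv ℝ (g.symm.trans f) (m - Y m)
    have hB : B - ContinuousLinearMap.id ℝ E =
        (2 : ℝ) • A + (B - ContinuousLinearMap.id ℝ E) ∘L A := by
      ext y
      have := DFunLike.congr_fun hm y
      simp only [ContinuousLinearMap.comp_apply, sub_apply,
        add_apply, one_apply_eq_self, map_sub,
        smul_apply, ContinuousLinearMap.id_apply] at this ⊢
      rw [sub_eq_iff_eq_add] at this
      rw [this, two_smul]
      abel
    have hle : ‖B - ContinuousLinearMap.id ℝ E‖ ≤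
        2 * ‖A‖ + ‖B - ContinuousLinearMap.id ℝ E‖ * ‖A‖ := by
      conv_lhs => rw [hB]
      refine (norm_add_le _ _).trans (add_le_add ?_ (ContinuousLinearMap.opNorm_comp_le _ _))
      simp [norm_smul]
    nlinarith [norm_nonneg (B - ContinuousLinearMap.id ℝ E), norm_nonneg A]
  · obtain ⟨m, rfl⟩ := hex x
    have hsurj : Function.Surjective (1 - fderiv ℝ Y m : E →L[ℝ] E) := by
      rw [sub_eq_add_neg]
      obtain ⟨e, he⟩ := ContinuousLinearMap.isInvertible_one_add_of_norm_lt_one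
        (A := -fderiv ℝ Y m) (by rw [norm_neg]; linarith [hY' m])
      rw [← he]
      exact e.surjective
    obtain ⟨u, rfl⟩ := hsurj u
    obtain ⟨w, rfl⟩ := hsurj w
    have hu := DFunLike.congr_fun (hderiv m) u
    have hw := DFunLike.congr_fun (hderiv m) w
    rw [ContinuousLinearMap.comp_apply] at hu hw
    rw [hu, hw]
    simp only [sub_apply, add_apply,
      one_apply_eq_self, map_sub, map_add]
    linarith [hΩ m u w]

end Cayley

section Hamiltonian

variable {E : Type*} [NormedAddCommGroup E] [InnerProductSpace ℝ E] [FiniteDimensional ℝ E]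

/-- For a complex structure `J`, there are compactly supported vector fields `Φ · v`, depending
linearly on `v`, that are Hamiltonian for the form `⟪J ·, ·⟫` and constant equal to `v` on a given
ball. -/
theorem exists_hamiltonian_cutoff (J : E →L[ℝ] E) (hskew : ∀ u w, ⟪J u, w⟫ = -⟪u, J w⟫)
    (hJ : ∀ u, J (J u) = -u) {a b : ℝ} (ha : 0 < a) (hab : a < b) :
    ∃ Φ : E → E →L[ℝ] E, ContDiff ℝ (⊤ : ℕ∞) Φ ∧ HasCompactSupport Φ ∧
      (∀ x, ‖x‖ ≤ a → Φ x = ContinuousLinearMap.id ℝ E) ∧ (∀ x, b ≤ ‖x‖ → Φ x = 0) ∧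
      ∀ x v u w, ⟪J (fderiv ℝ Φ x u v), w⟫ + ⟪J u, fderiv ℝ Φ x w v⟫ = 0 := by
  let χ : ContDiffBump (0 : E) := ⟨a, b, ha, hab⟩
  have hχ : ContDiff ℝ (⊤ : ℕ∞) χ := χ.contDiff
  have hχd : Differentiable ℝ χ := hχ.differentiable (by simp)
  have hχ' : ContDiff ℝ (⊤ : ℕ∞) (fderiv ℝ χ) := hχ.fderiv_right (by simp)
  let ψ : E → E := fun x ↦ -J ((InnerProductSpace.toDual ℝ E).symm (fderiv ℝ χ x))
  have hψ : ContDiff ℝ (⊤ : ℕ∞) ψ :=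
    (J.contDiff.comp ((InnerProductSpace.toDual ℝ E).symm.contDiff.comp hχ')).neg
  have hψJ : ∀ x w, ⟪J (ψ x), w⟫ = fderiv ℝ χ x w := fun x w ↦ by
    simp [ψ, hJ]
  let Φ : E → E →L[ℝ] E := fun x ↦
    χ x • ContinuousLinearMap.id ℝ E + ((innerSL ℝ x) ∘L J).smulRight (ψ x)
  have hΦ : ContDiff ℝ (⊤ : ℕ∞) Φ :=
    (hχ.smul contDiff_const).add
      ((((innerSL ℝ).contDiff).clm_comp contDiff_const).smulRight hψ)
  have hΦd : Differentiable ℝ Φ := hΦ.differentiable (by simp)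
  have hzero : ∀ x, b ≤ ‖x‖ → Φ x = 0 := fun x hx ↦ by
    have h0 : χ x = 0 := χ.zero_of_le_dist (by simpa using hx)
    have h1 : fderiv ℝ χ x = 0 :=
      IsLocalMin.fderiv_eq_zero (.of_forall fun y ↦ h0.trans_le χ.nonneg)
    ext v
    simp [Φ, ψ, h0, h1]
  refine ⟨Φ, hΦ, ?_, fun x hx ↦ ?_, hzero, ?_⟩
  · refine HasCompactSupport.intro (isCompact_closedBall (0 : E) b) fun x hx ↦ hzero x ?_
    rw [mem_closedBall_zero_iff, not_le] at hx
    exact hx.le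
  · have h0 : χ x = 1 := χ.one_of_mem_closedBall (by simpa using hx)
    have h1 : fderiv ℝ χ x = 0 :=
      IsLocalMax.fderiv_eq_zero (.of_forall fun y ↦ χ.le_one.trans_eq h0.symm)
    ext v
    simp [Φ, ψ, h0, h1]
  · intro x v u w
    have h1 : ∀ y, HasFDerivAt (fun y ↦ χ y * ⟪J v, y⟫) (innerSL ℝ (J (Φ y v))) y := by
      intro y
      refine ((hχd y).hasFDerivAt.mul (innerSL ℝ (J v)).hasFDerivAt).congr_fderiv ?_
      ext w
      simp [Φ, hψJ, real_inner_comm]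
    have h2 : HasFDerivAt (fun y ↦ innerSL ℝ (J (Φ y v)))
        ((innerSL ℝ ∘L J ∘L ContinuousLinearMap.apply ℝ E v) ∘L fderiv ℝ Φ x) x :=
      (innerSL ℝ ∘L J ∘L ContinuousLinearMap.apply ℝ E v).hasFDerivAt.comp x (hΦd x).hasFDerivAt
    have h3 : ⟪J (fderiv ℝ Φ x u v), w⟫ = ⟪J (fderiv ℝ Φ x w v), u⟫ :=
      second_derivative_symmetric h1 h2 u w
    rw [h3, hskew u, real_inner_comm, add_neg_cancel]

/-- The elementary perturbation lemma for the symplectic form `⟪J ·, ·⟫`. -/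
theorem exists_elementary_perturbation (J : E →L[ℝ] E) (hskew : ∀ u w, ⟪J u, w⟫ = -⟪u, J w⟫)
    (hJ : ∀ u, J (J u) = -u) {ε : ℝ} (hε : 0 < ε) :
    ∃ η : ℝ, 0 < η ∧ ∀ α : ℝ, 0 < α → α < 1 → ∀ (z : E) (r : ℝ), 0 < r → ∀ v : E, ‖v‖ = 1 →
      ∃ T : E ≃ E, ContDiff ℝ (⊤ : ℕ∞) ⇑T ∧ ContDiff ℝ (⊤ : ℕ∞) ⇑T.symm ∧
        (∀ x, x ∉ ball z (3 * r) → T x = x) ∧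
        (∀ x ∈ ball z (2 * r), T x = x + (α * η * r) • v) ∧
        (∀ y, ‖fderiv ℝ (⇑T) y - ContinuousLinearMap.id ℝ E‖ ≤ α) ∧
        (∀ x, ‖T x - x‖ ≤ ε * r) ∧
        (∀ x u w, ⟪J (fderiv ℝ (⇑T) x u), fderiv ℝ (⇑T) x w⟫ = ⟪J u, w⟫) := by
  obtain ⟨Φ, hΦ, hsupp, hone, hzero, hsymm⟩ :=
    exists_hamiltonian_cutoff J hskew hJ (a := 9 / 4) (b := 3) (by norm_num) (by norm_num)
  have hΦd : Differentiable ℝ Φ := hΦ.differentiable (by simp)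
  obtain ⟨C₀, hC₀⟩ : ∃ C₀, ∀ x, ‖Φ x‖ ≤ C₀ := hsupp.exists_bound_of_continuous hΦ.continuous
  obtain ⟨K, hK⟩ := hΦ.lipschitzWith_of_hasCompactSupport hsupp (by simp)
  obtain ⟨C₁, hC₁0, hC₁⟩ : ∃ C₁ : ℝ, 0 ≤ C₁ ∧ ∀ x, ‖fderiv ℝ Φ x‖ ≤ C₁ :=
    ⟨K, K.coe_nonneg, fun x ↦ norm_fderiv_le_of_lipschitz ℝ hK⟩
  have hC₀0 : 0 ≤ C₀ := (norm_nonneg _).trans (hC₀ 0)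
  obtain ⟨η, hη0, hη_half, hηC₁, hηC₀⟩ :
      ∃ η : ℝ, 0 < η ∧ η ≤ 1 / 2 ∧ 2 * (η * C₁) ≤ 1 ∧ η * C₀ ≤ ε := by
    have hD : 0 < 2 + 2 * C₁ + C₀ / ε := by positivity
    have hCε : 0 ≤ C₀ / ε := by positivity
    refine ⟨1 / (2 + 2 * C₁ + C₀ / ε), by positivity, ?_, ?_, ?_⟩
    · gcongr
      linarith
    · rw [one_div_mul_eq_div, ← mul_div_assoc, div_le_one hD]
      linarith
    · rw [one_div_mul_eq_div, div_le_iff₀ hD, mul_add, mul_div_cancel₀ _ hε.ne']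
      nlinarith
  refine ⟨η, hη0, ?_⟩
  intro α hα hα1 z r hr v hv
  obtain ⟨c, hc_eq⟩ : ∃ c, c = α * η * r / 2 := ⟨_, rfl⟩
  have hc : 0 < c := by rw [hc_eq]; positivity
  let Y : E → E := fun x ↦ c • Φ (r⁻¹ • (x - z)) v
  have hY : ContDiff ℝ (⊤ : ℕ∞) Y :=
    ((hΦ.comp (contDiff_const.smul (contDiff_id.sub contDiff_const))).clm_apply
      contDiff_const).const_smul c
  have hYd : ∀ x u, fderiv ℝ Y x u = (c * r⁻¹) • fderiv ℝ Φ (r⁻¹ • (x - z)) u v := fun x u ↦ by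
    have h1 : HasFDerivAt (fun x ↦ r⁻¹ • (x - z)) (r⁻¹ • ContinuousLinearMap.id ℝ E) x :=
      ((hasFDerivAt_id x).sub_const z).const_smul r⁻¹
    have h2 := (((ContinuousLinearMap.apply ℝ E v).hasFDerivAt.comp x
      ((hΦd _).hasFDerivAt.comp x h1))).const_smul c
    have h3 : fderiv ℝ Y x = _ := h2.fderiv
    rw [h3]
    simp [smul_smul]
  have hYle : ∀ x, ‖fderiv ℝ Y x‖ ≤ α * η * C₁ / 2 := fun x ↦ by
    refine ContinuousLinearMap.opNorm_le_bound _ (by positivity) fun u ↦ ?_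
    have hcr : c * r⁻¹ = α * η / 2 := by
      rw [hc_eq]
      field_simp
    rw [hYd, hcr, norm_smul, Real.norm_of_nonneg (by positivity)]
    have h1 : ‖fderiv ℝ Φ (r⁻¹ • (x - z)) u v‖ ≤ C₁ * ‖u‖ := by
      refine (ContinuousLinearMap.le_opNorm _ _).trans ?_
      rw [hv, mul_one]
      exact ContinuousLinearMap.le_of_opNorm_le _ (hC₁ _) u
    calc α * η / 2 * ‖fderiv ℝ Φ (r⁻¹ • (x - z)) u v‖ ≤ α * η / 2 * (C₁ * ‖u‖) := by gcongr
      _ = α * η * C₁ / 2 * ‖u‖ := by ring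
  have hδ : 4 * (α * η * C₁ / 2) ≤ α := by nlinarith
  obtain ⟨T, hT, hT', hTm, hex, hTd, hTΩ⟩ := exists_midpoint_diffeomorphism hY
    (by linarith) hYle (innerSL ℝ ∘L J) fun x u w ↦ by
      change ⟪J (fderiv ℝ Y x u), w⟫ + ⟪J u, fderiv ℝ Y x w⟫ = 0
      rw [hYd, hYd, map_smul, real_inner_smul_left, real_inner_smul_right, ← mul_add, hsymm,
        mul_zero]
  have hnorm : ∀ x, ‖r⁻¹ • (x - z)‖ = dist x z / r := fun x ↦ by
    rw [norm_smul, norm_inv, Real.norm_of_nonneg hr.le, dist_eq_norm, inv_mul_eq_div]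
  refine ⟨T, hT, hT', fun x hx ↦ ?_, fun x hx ↦ ?_, fun y ↦ (hTd y).trans hδ, fun x ↦ ?_, hTΩ⟩
  · have h0 : Y x = 0 := by
      simp only [Y]
      rw [hzero, zero_apply, smul_zero]
      rw [hnorm, le_div_iff₀ hr]
      simpa using hx
    simpa [h0] using hTm x
  · have hYm : Y (x + c • v) = c • v := by
      simp only [Y]
      rw [hone, ContinuousLinearMap.id_apply]
      rw [hnorm, div_le_iff₀ hr]
      have h1 : dist (x + c • v) z ≤ c + dist x z := by
        refine (dist_triangle _ x _).trans_eq ?_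
        rw [dist_self_add_left, norm_smul, hv, mul_one, Real.norm_of_nonneg hc.le]
      have h2 : c ≤ r / 4 := by
        have : α * η ≤ 1 / 2 := by nlinarith
        rw [hc_eq]
        nlinarith
      linarith [mem_ball.1 hx]
    have := hTm (x + c • v)
    rw [hYm, add_sub_cancel_right] at this
    rw [this, add_assoc, ← add_smul, hc_eq, add_halves]
  · obtain ⟨m, rfl⟩ := hex x
    have h1 : ‖Y m‖ ≤ c * C₀ := by
      simp only [Y]
      rw [norm_smul, Real.norm_of_nonneg hc.le]
      gcongr
      simpa [hv] using ContinuousLinearMap.le_of_opNorm_le _ (hC₀ (r⁻¹ • (m - z))) v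
    rw [hTm]
    calc ‖m + Y m - (m - Y m)‖ = ‖Y m + Y m‖ := by congr 1; abel
      _ ≤ c * C₀ + c * C₀ := norm_add_le_of_le h1 h1
      _ = α * (η * C₀) * r := by rw [hc_eq]; ring
      _ ≤ 1 * ε * r := by gcongr
      _ = ε * r := by ring

end Hamiltonian

/-- The standard complex structure `(p, q) ↦ (-q, p)` on `ℝ^{2n}`. -/
noncomputable def stdComplexStructure (n : ℕ) : SympSpace n →L[ℝ] SympSpace n :=
  (WithLp.prodContinuousLinearEquiv 2 ℝ _ _).symm.toContinuousLinearMap ∘L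
    (-WithLp.sndL 2 ℝ (EuclideanSpace ℝ (Fin n)) (EuclideanSpace ℝ (Fin n))).prod
      (WithLp.fstL 2 ℝ (EuclideanSpace ℝ (Fin n)) (EuclideanSpace ℝ (Fin n)))

theorem stdComplexStructure_apply (n : ℕ) (u : SympSpace n) :
    stdComplexStructure n u = WithLp.toLp 2 (-u.snd, u.fst) :=
  rfl

theorem stdSymplecticForm_eq_inner (n : ℕ) (u w : SympSpace n) :
    stdSymplecticForm n u w = ⟪stdComplexStructure n u, w⟫ := by
  rw [stdComplexStructure_apply, WithLp.prod_inner_apply]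
  simp [stdSymplecticForm]
  ring

theorem elementary_perturbation_symplectic (n : ℕ) (hn : 1 ≤ n) :
    ∃ η : ℝ, 0 < η ∧ ∃ α₀ : ℝ, 0 < α₀ ∧ α₀ < 1 ∧
      ∀ α : ℝ, 0 < α → α < α₀ →
      ∀ z : SympSpace n, ‖z‖ < 1/4 →
      ∀ r : ℝ, 0 < r → r < 1/4 →
      ∀ v : SympSpace n, ‖v‖ = 1 →
      ∃ T : SympSpace n ≃ SympSpace n,
        ContDiff ℝ (⊤ : ℕ∞) ⇑T ∧ ContDiff ℝ (⊤ : ℕ∞) ⇑T.symm ∧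
        (∀ x, x ∉ ball z (3 * r) → T x = x) ∧
        (∀ x ∈ ball z (2 * r), T x = x + (α * η * r) • v) ∧
        (∀ y, ‖fderiv ℝ (⇑T) y - ContinuousLinearMap.id ℝ (SympSpace n)‖ ≤ α) ∧
        (∀ x, ‖T x - x‖ ≤ r / (100 * ((2 * n : ℕ) : ℝ) ^ 2)) ∧
        (∀ x u w, stdSymplecticForm n (fderiv ℝ (⇑T) x u) (fderiv ℝ (⇑T) x w) =
          stdSymplecticForm n u w) := by
  have hn0 : (0 : ℝ) < n := by exact_mod_cast hn
  obtain ⟨η, hη, h⟩ := exists_elementary_perturbation (stdComplexStructure n)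
    (fun u w ↦ by
      simp only [stdComplexStructure_apply, WithLp.prod_inner_apply]
      simp)
    (fun u ↦ by
      simp only [stdComplexStructure_apply]
      rfl)
    (ε := 1 / (100 * ((2 * n : ℕ) : ℝ) ^ 2)) (by push_cast; positivity)
  refine ⟨η, hη, 1 / 2, by norm_num, by norm_num, fun α hα hα' z _ r hr _ v hv ↦ ?_⟩
  obtain ⟨T, h1, h2, h3, h4, h5, h6, h7⟩ := h α hα (by linarith) z r hr v hv
  refine ⟨T, h1, h2, h3, h4, h5, fun x ↦ (h6 x).trans_eq (one_div_mul_eq_div _ _), fun x u w ↦ ?_⟩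
  rw [stdSymplecticForm_eq_inner, stdSymplecticForm_eq_inner, h7]
end

section
/- Let n ≥ 1, let x₀ ∈ ℝ^n, let R > 0 and 0 ≤ δ < R, and let P : ℝ^n → ℝ^n be continuous on closedBall(x₀, R) with ‖P(x) − x‖ ≤ δ for every x ∈ closedBall(x₀, R). Then closedBall(x₀, R − δ) is contained in the image P '' closedBall(x₀, R). -/
open Metric Set

open MeasureTheory Polynomial Filter Topology

/-- If the integral of a family of polynomials of bounded degree is constant on a nontrivial
interval of parameters, it is constant. -/
theorem integral_eval_eq_of_forall_mem_Ioo {α : Type*} [MeasurableSpace α] {μ : Measure α}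
    {N : ℕ} {F : α → ℝ[X]} (hdeg : ∀ x, (F x).natDegree ≤ N)
    (hint : ∀ t, Integrable (fun x ↦ (F x).eval t) μ) {ε V : ℝ} (hε : 0 < ε)
    (hV : ∀ t ∈ Ioo 0 ε, ∫ x, (F x).eval t ∂μ = V) (t : ℝ) :
    ∫ x, (F x).eval t ∂μ = V := by
  set v : ℕ → ℝ := fun i ↦ ε / (i + 2) with hv
  have hinj : Set.InjOn v (Finset.range (N + 1)) := by
    intro i _ j _ hij
    have hi : (i : ℝ) + 2 ≠ 0 := by positivity
    have hj : (j : ℝ) + 2 ≠ 0 := by positivity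
    simp only [hv] at hij
    rw [div_eq_div_iff hi hj] at hij
    have := mul_left_cancel₀ hε.ne' hij
    exact_mod_cast (add_right_cancel this).symm
  have hmem (i : ℕ) : v i ∈ Ioo 0 ε := by
    refine ⟨by positivity, div_lt_self hε ?_⟩
    have : (0 : ℝ) ≤ i := i.cast_nonneg
    linarith
  have key (x : α) : (F x).eval t = ∑ i ∈ Finset.range (N + 1),
      (F x).eval (v i) * (Lagrange.basis (Finset.range (N + 1)) v i).eval t := by
    have hlt : (F x).degree < (Finset.range (N + 1)).card := by
      rw [Finset.card_range]
      exact degree_le_natDegree.trans_lt (by exact_mod_cast Nat.lt_succ_of_le (hdeg x))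
    conv_lhs => rw [Lagrange.eq_interpolate hinj hlt]
    simp [Lagrange.interpolate_apply, eval_finsetSum]
  simp_rw [key]
  rw [integral_finsetSum _ fun i _ ↦ (hint _).mul_const _]
  simp_rw [integral_mul_const, hV _ (hmem _)]
  rw [← Finset.mul_sum, ← eval_finsetSum, Lagrange.sum_basis hinj (by simp)]
  simp

variable {E : Type*} [NormedAddCommGroup E]

theorem Matrix.eval_det_X_smul_add_one {ι : Type*} [Fintype ι] [DecidableEq ι]
    (M : Matrix ι ι ℝ) (t : ℝ) :
    ((X : ℝ[X]) • M.map C + (1 : Matrix ι ι ℝ).map C).det.eval t = (t • M + 1).det := by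
  rw [← coe_evalRingHom, RingHom.map_det]
  congr 1
  ext i j
  by_cases hij : i = j <;> simp [hij, mul_comm t]

theorem ContinuousLinearMap.exists_polynomial_eval_eq_det_id_add_smul [NormedSpace ℝ E]
    [FiniteDimensional ℝ E] (A : E →L[ℝ] E) :
    ∃ q : ℝ[X], q.natDegree ≤ Module.finrank ℝ E ∧
      ∀ t, q.eval t = (ContinuousLinearMap.id ℝ E + t • A).det := by
  classical
  have b := Module.finBasis ℝ E
  refine ⟨_, (natDegree_det_X_add_C_le (LinearMap.toMatrix b b A.toLinearMap) 1).trans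
    (Fintype.card_fin _).le, fun t ↦ ?_⟩
  rw [Matrix.eval_det_X_smul_add_one, ContinuousLinearMap.det, ← LinearMap.det_toMatrix b,
    ContinuousLinearMap.toLinearMap_add, ContinuousLinearMap.toLinearMap_smul,
    map_add, map_smul, ContinuousLinearMap.coe_id, LinearMap.toMatrix_id, add_comm]

theorem LipschitzWith.bijective_id_add [CompleteSpace E] {g : E → E} {K : NNReal}
    (hg : LipschitzWith K g) (hK : K < 1) : Function.Bijective fun x ↦ x + g x := by
  refine ⟨fun x y hxy ↦ ?_, fun y ↦ ?_⟩
  · have h := hg.dist_le_mul x y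
    have h' : dist (g x) (g y) = dist x y := by
      rw [dist_eq_norm, dist_eq_norm, ← norm_neg]
      congr 1
      rw [neg_sub, sub_eq_sub_iff_add_eq_add, add_comm]
      exact hxy.symm
    rw [h'] at h
    have hK' : (K : ℝ) < 1 := hK
    exact dist_le_zero.1 (by nlinarith [dist_nonneg (x := x) (y := y)])
  · have hc : ContractingWith K fun x ↦ y - g x :=
      ⟨hK, LipschitzWith.of_dist_le_mul fun a b ↦ by
        rw [dist_sub_left]; exact hg.dist_le_mul a b⟩
    obtain ⟨x, hx, -⟩ := hc.exists_fixedPoint y (edist_ne_top _ _)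
    exact ⟨x, by rw [← eq_sub_iff_add_eq]; exact hx.symm⟩

/-- A bijection fixing all points outside `s` maps `s` onto itself. -/
theorem Function.Bijective.image_eq_of_forall_notMem {α : Type*} {f : α → α}
    (hf : Function.Bijective f) {s : Set α} (hs : ∀ x ∉ s, f x = x) : f '' s = s := by
  rw [← compl_inj_iff, ← image_compl_eq hf]
  exact (image_congr hs).trans (image_id _)

variable [InnerProductSpace ℝ E] [FiniteDimensional ℝ E] [MeasurableSpace E] [BorelSpace E]

/-- Change of variables for a small perturbation of the identity supported in `s`. -/
theorem exists_forall_setIntegral_comp_id_add_smul_mul_det_eq {g : E → E} {K : NNReal}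
    (hg : Differentiable ℝ g) (hK : LipschitzWith K g) {s : Set E} (hs : MeasurableSet s)
    (hgs : ∀ x ∉ s, g x = 0) :
    ∃ ε > (0 : ℝ), ∀ t ∈ Ioo 0 ε, ∀ φ : E → ℝ,
      ∫ x in s, φ (x + t • g x) * (ContinuousLinearMap.id ℝ E + t • fderiv ℝ g x).det
        = ∫ x in s, φ x := by
  obtain ⟨η, hη, hdet⟩ : ∃ η > 0, ∀ A : E →L[ℝ] E,
      dist A (ContinuousLinearMap.id ℝ E) < η → 0 < A.det := by
    refine Metric.eventually_nhds_iff.1 <|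
      (ContinuousLinearMap.continuous_det.tendsto _).eventually_const_lt ?_
    simp [ContinuousLinearMap.det]
  refine ⟨min 1 η / (K + 1), by positivity, fun t ht φ ↦ ?_⟩
  have htK : t * (K + 1) < min 1 η := (lt_div_iff₀ (by positivity)).1 ht.2
  have htK' : t * K < min 1 η := by linarith [ht.1]
  have hbij : Function.Bijective fun x ↦ x + t • g x := by
    refine LipschitzWith.bijective_id_add (K := t.toNNReal * K)
      (LipschitzWith.of_dist_le_mul fun x y ↦ ?_) ?_
    · rw [dist_smul₀, Real.norm_of_nonneg ht.1.le, NNReal.coe_mul, Real.coe_toNNReal _ ht.1.le,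
        mul_assoc]
      exact mul_le_mul_of_nonneg_left (hK.dist_le_mul x y) ht.1.le
    · rw [← NNReal.coe_lt_coe, NNReal.coe_mul, Real.coe_toNNReal _ ht.1.le]
      exact htK'.trans_le (min_le_left _ _)
  have himage := hbij.image_eq_of_forall_notMem (s := s) fun x hx ↦ by simp [hgs x hx]
  have hderiv (x : E) : HasFDerivAt (fun x ↦ x + t • g x)
      (ContinuousLinearMap.id ℝ E + t • fderiv ℝ g x) x :=
    (hasFDerivAt_id x).add ((hg x).hasFDerivAt.const_smul t)
  conv_rhs => rw [← himage]
  rw [integral_image_eq_integral_abs_det_fderiv_smul volume hs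
    (fun x _ ↦ (hderiv x).hasFDerivWithinAt) hbij.injective.injOn]
  congr 1 with x
  rw [abs_of_pos (hdet _ ?_), smul_eq_mul, mul_comm]
  rw [dist_eq_norm, add_sub_cancel_left, norm_smul, Real.norm_of_nonneg ht.1.le]
  calc t * ‖fderiv ℝ g x‖ ≤ t * K :=
        mul_le_mul_of_nonneg_left (norm_fderiv_le_of_lipschitz ℝ hK) ht.1.le
    _ < η := htK'.trans_le (min_le_right _ _)

/-- The degree of a compactly supported perturbation of the identity is one, tested against
polynomials in the squared distance to a point. -/
theorem setIntegral_eval_norm_sub_sq_mul_det_eq {g : E → E} (hg : ContDiff ℝ 1 g)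
    (hgc : HasCompactSupport g) {s : Set E} (hs : IsCompact s) (hgs : ∀ x ∉ s, g x = 0)
    (y : E) (p : ℝ[X]) :
    ∫ x in s, p.eval (‖x + g x - y‖ ^ 2) * (ContinuousLinearMap.id ℝ E + fderiv ℝ g x).det
      = ∫ x in s, p.eval (‖x - y‖ ^ 2) := by
  obtain ⟨K, hK⟩ := hg.lipschitzWith_of_hasCompactSupport hgc one_ne_zero
  obtain ⟨ε, hε, h⟩ := exists_forall_setIntegral_comp_id_add_smul_mul_det_eq
    (hg.differentiable one_ne_zero) hK hs.measurableSet hgs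
  choose q hqdeg hq using fun x ↦
    (fderiv ℝ g x).exists_polynomial_eval_eq_det_id_add_smul
  let r (x : E) : ℝ[X] :=
    C (‖g x‖ ^ 2) * X ^ 2 + C (2 * inner ℝ (x - y) (g x)) * X + C (‖x - y‖ ^ 2)
  have hr (x : E) (t : ℝ) : (r x).eval t = ‖x + t • g x - y‖ ^ 2 := by
    rw [add_sub_right_comm, norm_add_sq_real, norm_smul, inner_smul_right, mul_pow,
      Real.norm_eq_abs, sq_abs]
    simp only [r, eval_add, eval_mul, eval_C, eval_pow, eval_X]
    ring
  have heval (x : E) (t : ℝ) : (p.comp (r x) * q x).eval t =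
      p.eval (‖x + t • g x - y‖ ^ 2) * (ContinuousLinearMap.id ℝ E + t • fderiv ℝ g x).det := by
    rw [eval_mul, eval_comp, hr, hq]
  have hfderiv : Continuous (fderiv ℝ g) := hg.continuous_fderiv one_ne_zero
  have hcont : Continuous g := hg.continuous
  have key := integral_eval_eq_of_forall_mem_Ioo (μ := volume.restrict s)
    (F := fun x ↦ p.comp (r x) * q x) (N := p.natDegree * 2 + Module.finrank ℝ E)
    (fun x ↦ natDegree_mul_le_of_le (natDegree_comp_le.trans
      (Nat.mul_le_mul_left _ natDegree_quadratic_le)) (hqdeg x))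
    (fun t ↦ by
      simp_rw [heval]
      refine Continuous.continuousOn ?_ |>.integrableOn_compact hs
      refine (p.continuous.comp (by fun_prop)).mul
        (ContinuousLinearMap.continuous_det.comp (by fun_prop)))
    hε (fun t ht ↦ by
      simp_rw [heval]
      exact h t ht fun z ↦ p.eval (‖z - y‖ ^ 2)) 1
  simpa only [heval, one_smul] using key

theorem exists_norm_add_sub_lt_of_contDiff {g : E → E} (hg : ContDiff ℝ 1 g)
    (hgc : HasCompactSupport g) (y : E) {ε : ℝ} (hε : 0 < ε) : ∃ x, ‖x + g x - y‖ < ε := by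
  by_contra! hfar
  obtain ⟨C₀, hC₀⟩ := hgc.exists_bound_of_continuous hg.continuous
  have hC₀nn : 0 ≤ C₀ := (norm_nonneg _).trans (hC₀ y)
  obtain ⟨ρ₀, hρ₀⟩ := hgc.isCompact.isBounded.subset_closedBall y
  set ρ := max ρ₀ ε
  have hερ : ε ≤ ρ := le_max_right _ _
  have hgs (x : E) (hx : x ∉ closedBall y ρ) : g x = 0 :=
    image_eq_zero_of_notMem_tsupport fun h ↦
      hx (closedBall_subset_closedBall (le_max_left _ _) (hρ₀ h))
  set M := (ρ + C₀) ^ 2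
  have hMpos : 0 < M := by positivity
  have hεM : ε ^ 2 ≤ M := pow_le_pow_left₀ hε.le (by linarith) 2
  have hball (x : E) (hx : x ∈ closedBall y ρ) : ‖x - y‖ ^ 2 ≤ M :=
    pow_le_pow_left₀ (norm_nonneg _) ((mem_closedBall_iff_norm.1 hx).trans (by linarith)) 2
  have hnorm (x : E) (hx : x ∈ closedBall y ρ) : ‖x + g x - y‖ ^ 2 ≤ M := by
    refine pow_le_pow_left₀ (norm_nonneg _) ?_ 2
    rw [add_sub_right_comm]
    exact (norm_add_le _ _).trans (add_le_add (mem_closedBall_iff_norm.1 hx) (hC₀ x))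
  let J (x : E) : ℝ := (ContinuousLinearMap.id ℝ E + fderiv ℝ g x).det
  have hfderiv : Continuous (fderiv ℝ g) := hg.continuous_fderiv one_ne_zero
  have hJ : Continuous J := ContinuousLinearMap.continuous_det.comp (by fun_prop)
  have hcont : Continuous g := hg.continuous
  have hs : IsCompact (closedBall y ρ) := isCompact_closedBall y ρ
  set D := ∫ x in closedBall y ρ, |J x| with hD
  have hDnn : 0 ≤ D := integral_nonneg fun x ↦ abs_nonneg _
  set c := volume.real (closedBall y (ε / 2))
  have hcpos : 0 < c := ENNReal.toReal_pos
    (measure_closedBall_pos volume y (half_pos hε)).ne' measure_closedBall_lt_top.ne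
  set a := 1 - ε ^ 2 / M with ha
  set b := 1 - (ε / 2) ^ 2 / M with hb
  have hab : a < b := sub_lt_sub_left (by gcongr; linarith) 1
  have ha0 : 0 ≤ a := sub_nonneg.2 ((div_le_one hMpos).2 hεM)
  have hb0 : 0 < b := ha0.trans_lt hab
  have hle (k : ℕ) : b ^ k * c ≤ a ^ k * D := by
    have key := setIntegral_eval_norm_sub_sq_mul_det_eq hg hgc hs hgs y
      ((1 - Polynomial.C M⁻¹ * X) ^ k)
    simp only [eval_pow, eval_sub, eval_one, eval_mul, eval_C, eval_X, inv_mul_eq_div] at key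
    have hlower : b ^ k * c ≤ ∫ x in closedBall y ρ, (1 - ‖x - y‖ ^ 2 / M) ^ k := by
      calc b ^ k * c = ∫ x in closedBall y (ε / 2), b ^ k := by
            rw [setIntegral_const, smul_eq_mul, mul_comm]
        _ ≤ ∫ x in closedBall y (ε / 2), (1 - ‖x - y‖ ^ 2 / M) ^ k := by
            refine setIntegral_mono_on
              (continuousOn_const.integrableOn_compact (isCompact_closedBall _ _))
              (Continuous.continuousOn (by fun_prop) |>.integrableOn_compact
                (isCompact_closedBall _ _)) measurableSet_closedBall fun x hx ↦ ?_
            have := mem_closedBall_iff_norm.1 hx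
            exact pow_le_pow_left₀ hb0.le (by rw [hb]; gcongr) k
        _ ≤ _ := by
            refine setIntegral_mono_set
              (Continuous.continuousOn (by fun_prop) |>.integrableOn_compact hs) ?_
              (closedBall_subset_closedBall (by linarith)).eventuallyLE
            filter_upwards [ae_restrict_mem measurableSet_closedBall] with x hx
            exact pow_nonneg (sub_nonneg.2 ((div_le_one hMpos).2 (hball x hx))) k
    have hupper : ∫ x in closedBall y ρ, (1 - ‖x + g x - y‖ ^ 2 / M) ^ k * J x ≤ a ^ k * D := by
      rw [hD, ← integral_const_mul]
      refine setIntegral_mono_on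
        (Continuous.continuousOn (by fun_prop) |>.integrableOn_compact hs)
        (Continuous.continuousOn (by fun_prop) |>.integrableOn_compact hs)
        measurableSet_closedBall fun x hx ↦ ?_
      have h0 : 0 ≤ 1 - ‖x + g x - y‖ ^ 2 / M :=
        sub_nonneg.2 ((div_le_one hMpos).2 (hnorm x hx))
      have h1 : 1 - ‖x + g x - y‖ ^ 2 / M ≤ a := by
        have := hfar x
        rw [ha]
        gcongr
      calc (1 - ‖x + g x - y‖ ^ 2 / M) ^ k * J x
          ≤ (1 - ‖x + g x - y‖ ^ 2 / M) ^ k * |J x| := by gcongr; exact le_abs_self _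
        _ ≤ a ^ k * |J x| := by gcongr
    exact hlower.trans (key.symm.le.trans hupper)
  obtain ⟨k, hk⟩ := exists_pow_lt_of_lt_one (show 0 < c / (D + 1) by positivity)
    ((div_lt_one hb0).2 hab)
  rw [div_pow, div_lt_div_iff₀ (by positivity) (by positivity)] at hk
  nlinarith [hle k, pow_nonneg ha0 k]

/-- A compactly supported continuous perturbation of the identity is surjective. -/
theorem HasCompactSupport.surjective_id_add {w : E → E} (hwc : HasCompactSupport w)
    (hw : Continuous w) : Function.Surjective fun x ↦ x + w x := by
  intro y
  obtain ⟨C₀, hC₀⟩ := hwc.exists_bound_of_continuous hw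
  have htends : Tendsto (fun x ↦ ‖x + w x - y‖) (cocompact E) atTop := by
    refine tendsto_atTop_mono (fun x ↦ ?_)
      (tendsto_atTop_add_const_right _ (-(C₀ + ‖y‖)) (tendsto_norm_cocompact_atTop (E := E)))
    have h₁ : ‖x‖ ≤ ‖x + w x - y‖ + ‖y - w x‖ := by
      simpa using norm_add_le (x + w x - y) (y - w x)
    linarith [norm_sub_le y (w x), hC₀ x]
  obtain ⟨x, hx⟩ := Continuous.exists_forall_le (by fun_prop) htends
  refine ⟨x, sub_eq_zero.1 (norm_le_zero_iff.1 (le_of_forall_pos_le_add fun η hη ↦ ?_))⟩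
  obtain ⟨g, hg, hgw, hsupp⟩ := hw.exists_contDiff_approx 1 (ε := fun _ ↦ η / 2)
    continuous_const fun _ ↦ half_pos hη
  obtain ⟨z, hz⟩ := exists_norm_add_sub_lt_of_contDiff hg (hwc.mono hsupp) y (half_pos hη)
  have hzw := hgw z
  rw [dist_comm, dist_eq_norm] at hzw
  have h₂ : ‖z + w z - y‖ ≤ ‖z + g z - y‖ + ‖w z - g z‖ := by
    rw [show z + w z - y = (z + g z - y) + (w z - g z) by abel]
    exact norm_add_le _ _
  linarith [hx z]

/-- The radial retraction onto a closed ball. -/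
theorem exists_continuous_retraction_closedBall {F : Type*} [NormedAddCommGroup F]
    [NormedSpace ℝ F] (x₀ : F) {R : ℝ} (hR : 0 < R) :
    ∃ r : F → F, Continuous r ∧ (∀ x, r x ∈ closedBall x₀ R) ∧
      ∀ x ∈ closedBall x₀ R, r x = x := by
  have hpos (x : F) : 0 < max R ‖x - x₀‖ := hR.trans_le (le_max_left _ _)
  refine ⟨fun x ↦ x₀ + (R / max R ‖x - x₀‖) • (x - x₀), ?_, fun x ↦ ?_, fun x hx ↦ ?_⟩
  · have := fun x ↦ (hpos x).ne'
    fun_prop (disch := assumption)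
  · rw [mem_closedBall_iff_norm, add_sub_cancel_left, norm_smul,
      Real.norm_of_nonneg (div_pos hR (hpos x)).le, div_mul_eq_mul_div, div_le_iff₀ (hpos x)]
    gcongr
    exact le_max_right _ _
  · simp only
    rw [max_eq_left (mem_closedBall_iff_norm.1 hx), div_self hR.ne', one_smul,
      add_sub_cancel]

theorem brouwer_quantitative_surjectivity (n : ℕ) (hn : 1 ≤ n)
    (x₀ : EuclideanSpace ℝ (Fin n)) (R δ : ℝ) (hδ : 0 ≤ δ) (hδR : δ < R)
    (P : EuclideanSpace ℝ (Fin n) → EuclideanSpace ℝ (Fin n))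
    (hP : ContinuousOn P (closedBall x₀ R))
    (hclose : ∀ x ∈ closedBall x₀ R, ‖P x - x‖ ≤ δ) :
    closedBall x₀ (R - δ) ⊆ P '' closedBall x₀ R := by
  intro y hy
  have hR : 0 < R := hδ.trans_lt hδR
  obtain ⟨r, hr, hrmem, hrid⟩ := exists_continuous_retraction_closedBall x₀ hR
  let χ : ContDiffBump x₀ := ⟨R, R + 1, hR, lt_add_one R⟩
  let w (x : EuclideanSpace ℝ (Fin n)) := χ x • (P (r x) - r x)
  have hw : Continuous w :=
    χ.continuous.smul ((hP.comp_continuous hr hrmem).sub hr)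
  have hwδ (x) : ‖w x‖ ≤ δ := by
    rw [norm_smul, Real.norm_of_nonneg χ.nonneg]
    exact (mul_le_of_le_one_left (norm_nonneg _) χ.le_one).trans (hclose _ (hrmem x))
  obtain ⟨x, hx⟩ := HasCompactSupport.surjective_id_add
    (χ.hasCompactSupport.smul_right (f' := fun x ↦ P (r x) - r x)) hw y
  replace hx : x + w x = y := hx
  have hxR : x ∈ closedBall x₀ R := by
    rw [mem_closedBall_iff_norm] at hy ⊢
    have h : ‖x - x₀‖ ≤ ‖y - x₀‖ + ‖w x‖ := by
      rw [show x - x₀ = (y - x₀) - w x by rw [← hx]; abel]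
      exact norm_sub_le _ _
    linarith [hwδ x]
  refine ⟨x, hxR, ?_⟩
  simpa [w, hrid x hxR, χ.one_of_mem_closedBall hxR] using hx
end

section
/- Let d ≥ 1, let (v₁, …, v_d) be an orthonormal basis of ℝ^d, let x₀ ∈ ℝ^d, let a > 0, λ > 0 and 0 ≤ δ < a·λ, and let P : [−a, a]^d → ℝ^d be a continuous map satisfying ‖P(t₁, …, t_d) − (x₀ + Σ_i t_i·λ·v_i)‖ ≤ δ for every (t₁, …, t_d) ∈ [−a, a]^d. Then the image of P contains the closed ball closedBall(x₀, a·λ − δ). -/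
open Metric Set

/-! ### Perturbations of the identity and their Jacobian determinants -/

section Perturbation

open MeasureTheory
open scoped NNReal

/-- Evaluation at `1` of a polynomial of bounded degree is a fixed linear combination of its values
at small positive nodes; applied to `t ↦ det (1 + t • A)`. -/
theorem exists_weights_det_one_add {ι : Type*} [Fintype ι] {ε : ℝ} (hε : 0 < ε) :
    ∃ (t w : Fin (Fintype.card ι + 1) → ℝ), (∀ j, 0 < t j ∧ t j < ε) ∧ ∑ j, w j = 1 ∧
      ∀ A : (ι → ℝ) →L[ℝ] (ι → ℝ), (1 + A).det = ∑ j, w j * (1 + t j • A).det := by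
  classical
  let t : Fin (Fintype.card ι + 1) → ℝ := fun j => ε / ((j : ℝ) + 2)
  have ht : Function.Injective t := by
    intro i j hij
    have hi : ((i : ℝ) + 2) ≠ 0 := by positivity
    have hj : ((j : ℝ) + 2) ≠ 0 := by positivity
    have h : ε / ((i : ℝ) + 2) = ε / ((j : ℝ) + 2) := hij
    rw [div_eq_div_iff hi hj] at h
    have h2 := mul_left_cancel₀ hε.ne' h
    have h3 : (i : ℝ) = j := by linarith
    exact Fin.ext (by exact_mod_cast h3)
  refine ⟨t, fun j => (Lagrange.basis Finset.univ t j).eval 1, fun j => ⟨by positivity, ?_⟩, ?_, ?_⟩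
  · apply div_lt_self hε
    have : (0 : ℝ) ≤ j := by positivity
    linarith
  · rw [← Polynomial.eval_finsetSum, Lagrange.sum_basis ht.injOn Finset.univ_nonempty,
      Polynomial.eval_one]
  · intro A
    let M : Matrix ι ι ℝ := LinearMap.toMatrix' (A : (ι → ℝ) →ₗ[ℝ] (ι → ℝ))
    let p : Polynomial ℝ :=
      ((Polynomial.X : Polynomial ℝ) • M.map Polynomial.C + (1 : Matrix ι ι ℝ).map Polynomial.C).det
    have hp : ∀ s : ℝ, p.eval s = (1 + s • A).det := by
      intro s
      have h1 : (1 + s • A).det = (1 + s • M).det := by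
        rw [ContinuousLinearMap.det, ← LinearMap.det_toMatrix']
        congr 1
        simp [M, ContinuousLinearMap.one_def]
      rw [h1, ← Polynomial.coe_evalRingHom, RingHom.map_det]
      congr 1
      ext i j
      by_cases hij : i = j <;> simp [hij, add_comm, mul_comm (M _ _) s]
    have hdeg : p.degree < (Finset.univ : Finset (Fin (Fintype.card ι + 1))).card := by
      refine Polynomial.degree_le_natDegree.trans_lt ?_
      have := Polynomial.natDegree_det_X_add_C_le M 1
      rw [Finset.card_univ, Fintype.card_fin]
      exact_mod_cast Nat.lt_succ_of_le this
    have hint := congrArg (Polynomial.eval 1) (Lagrange.eq_interpolate ht.injOn hdeg)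
    rw [hp, one_smul, Lagrange.interpolate_apply, Polynomial.eval_finsetSum] at hint
    rw [hint]
    refine Finset.sum_congr rfl fun j _ => ?_
    rw [Polynomial.eval_mul, Polynomial.eval_C, hp, mul_comm]

theorem bijective_add_of_lipschitzWith {E : Type*} [NormedAddCommGroup E] [CompleteSpace E]
    {K : ℝ≥0} {g : E → E} (hK : K < 1) (hg : LipschitzWith K g) :
    Function.Bijective fun x => x + g x := by
  have hc : ∀ y, ContractingWith K fun x => y - g x := fun y =>
    ⟨hK, LipschitzWith.of_dist_le_mul fun a b => by
      rw [dist_sub_left]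
      exact hg.dist_le_mul a b⟩
  constructor
  · intro a b hab
    have hab : a + g a = b + g b := hab
    refine (hc (a + g a)).fixedPoint_unique' (x := a) (y := b) ?_ ?_
    · simp [Function.IsFixedPt]
    · simp [Function.IsFixedPt, hab]
  · intro y
    refine ⟨ContractingWith.fixedPoint _ (hc y), ?_⟩
    have h := (hc y).fixedPoint_isFixedPt
    have h' : y - g (ContractingWith.fixedPoint _ (hc y)) = ContractingWith.fixedPoint _ (hc y) := h
    exact (sub_eq_iff_eq_add.mp h').symm

theorem image_add_ball_eq {E : Type*} [NormedAddCommGroup E] {g : E → E} {R : ℝ}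
    (hbij : Function.Bijective fun x => x + g x) (h0 : ∀ x, R ≤ ‖x‖ → g x = 0) :
    (fun x => x + g x) '' ball 0 R = ball 0 R := by
  ext y
  simp only [mem_image, mem_ball_zero_iff]
  constructor
  · rintro ⟨x, hx, rfl⟩
    by_contra! h
    have : x + g x = x := hbij.1 (by simp [h0 _ h])
    rw [this] at h
    linarith
  · intro hy
    obtain ⟨x, rfl⟩ := hbij.2 y
    refine ⟨x, ?_, rfl⟩
    by_contra! h
    simp only [h0 x h, add_zero] at hy
    linarith

theorem LipschitzWith.volume_image_eq_zero {ι : Type*} [Fintype ι] {K : ℝ≥0}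
    {h : (ι → ℝ) → (ι → ℝ)} (hh : LipschitzWith K h) {s : Set (ι → ℝ)} (hs : volume s = 0) :
    volume (h '' s) = 0 := by
  rw [← hausdorffMeasure_pi_real] at hs ⊢
  have := hh.hausdorffMeasure_image_le (d := (Fintype.card ι : ℝ)) (by positivity) s
  rw [hs, mul_zero] at this
  exact nonpos_iff_eq_zero.1 this

/-- If the sup norm of a map is locally bounded by its value at a point, then its derivative there
is singular. -/
theorem HasFDerivAt.det_eq_zero_of_isLocalMax_norm {ι : Type*} [Fintype ι] [Nonempty ι]
    {h : (ι → ℝ) → (ι → ℝ)} {A : (ι → ℝ) →L[ℝ] (ι → ℝ)} {x : ι → ℝ} (hA : HasFDerivAt h A x)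
    (hmax : IsLocalMax (fun y => ‖h y‖) x) : A.det = 0 := by
  obtain ⟨i, hi⟩ : ∃ i, ‖h x‖ ≤ ‖h x i‖ := by
    by_contra! hcon
    obtain ⟨j⟩ := ‹Nonempty ι›
    have hpos : 0 < ‖h x‖ := (norm_nonneg _).trans_lt (hcon j)
    exact lt_irrefl _ ((pi_norm_lt_iff hpos).2 hcon)
  have hAi : HasFDerivAt (fun y => h y i) ((ContinuousLinearMap.proj i).comp A) x :=
    hasFDerivAt_pi'.1 hA i
  have hext : IsLocalExtr (fun y => h y i) x := by
    rcases le_total 0 (h x i) with hs | hs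
    · right
      filter_upwards [hmax] with y hy
      rw [Real.norm_of_nonneg hs] at hi
      exact (le_abs_self _).trans ((norm_le_pi_norm (h y) i).trans (hy.trans hi))
    · left
      filter_upwards [hmax] with y hy
      rw [Real.norm_of_nonpos hs] at hi
      have := (neg_le_abs _).trans ((norm_le_pi_norm (h y) i).trans (hy.trans hi))
      linarith
  have hzero := hext.hasFDerivAt_eq_zero hAi
  by_contra hdet
  have hunit : IsUnit (LinearMap.det (A : (ι → ℝ) →ₗ[ℝ] (ι → ℝ))) := isUnit_iff_ne_zero.2 hdet
  obtain ⟨v, hv⟩ := (LinearMap.equivOfIsUnitDet hunit).surjective (fun _ => (1 : ℝ))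
  have hv' : A v = fun _ => (1 : ℝ) := by
    rwa [LinearMap.equivOfIsUnitDet_apply] at hv
  have := DFunLike.congr_fun hzero v
  simp [hv'] at this

theorem exists_pos_forall_det_one_add_pos (ι : Type*) [Fintype ι] :
    ∃ ε : ℝ, 0 < ε ∧ ∀ A : (ι → ℝ) →L[ℝ] (ι → ℝ), ‖A‖ < ε → 0 < (1 + A).det := by
  have hcont : Continuous fun A : (ι → ℝ) →L[ℝ] (ι → ℝ) => (1 + A).det :=
    ContinuousLinearMap.continuous_det.comp (continuous_const.add continuous_id)
  have h1 : 0 < (1 + (0 : (ι → ℝ) →L[ℝ] (ι → ℝ))).det := by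
    simp [ContinuousLinearMap.det, ContinuousLinearMap.one_def]
  obtain ⟨ε, hε, h⟩ := Metric.eventually_nhds_iff.1
    (hcont.continuousAt.eventually (lt_mem_nhds h1))
  exact ⟨ε, hε, fun A hA => h (by simpa using hA)⟩

/-- For small `t`, the map `x ↦ x + t • g x` preserves the ball outside of which `g` vanishes, hence
its Jacobian determinant integrates to the volume of the ball. -/
theorem integral_det_one_add_smul_fderiv {ι : Type*} [Fintype ι] {K : ℝ≥0} {R t : ℝ}
    {g : (ι → ℝ) → (ι → ℝ)} (hg : LipschitzWith K g) (h0 : ∀ x, R ≤ ‖x‖ → g x = 0)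
    (ht : 0 ≤ t) (htK : t * K < 1) (hpos : ∀ x, 0 < (1 + t • fderiv ℝ g x).det) :
    IntegrableOn (fun x => (1 + t • fderiv ℝ g x).det)
        (ball 0 R ∩ {x | DifferentiableAt ℝ g x}) ∧
      ∫ x in ball 0 R ∩ {x | DifferentiableAt ℝ g x}, (1 + t • fderiv ℝ g x).det =
        volume.real (ball (0 : ι → ℝ) R) := by
  set D : Set (ι → ℝ) := ball 0 R ∩ {x | DifferentiableAt ℝ g x}
  have hDm : MeasurableSet D := measurableSet_ball.inter (measurableSet_of_differentiableAt ℝ g)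
  have htg : LipschitzWith (t.toNNReal * K) fun x => t • g x :=
    LipschitzWith.of_dist_le_mul fun a b => by
      rw [dist_smul₀, Real.norm_of_nonneg ht, NNReal.coe_mul, Real.coe_toNNReal _ ht, mul_assoc]
      exact mul_le_mul_of_nonneg_left (hg.dist_le_mul a b) ht
  have hlt : t.toNNReal * K < 1 := by
    rw [← NNReal.coe_lt_coe, NNReal.coe_mul, Real.coe_toNNReal _ ht]
    exact_mod_cast htK
  have hbij := bijective_add_of_lipschitzWith hlt htg
  have himg := image_add_ball_eq hbij (R := R) fun x hx => by simp [h0 x hx]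
  have hderiv : ∀ x ∈ D,
      HasFDerivWithinAt (fun x => x + t • g x) (1 + t • fderiv ℝ g x) D x := fun x hx =>
    ((hasFDerivAt_id x).add (hx.2.hasFDerivAt.const_smul t)).hasFDerivWithinAt
  have hnull : volume (ball (0 : ι → ℝ) R \ D) = 0 := by
    refine measure_mono_null (fun x hx => ?_) (ae_iff.1 hg.ae_differentiableAt)
    exact fun hd => hx.2 ⟨hx.1, hd⟩
  have hvol : volume ((fun x => x + t • g x) '' D) = volume (ball (0 : ι → ℝ) R) := by
    refine le_antisymm (measure_mono ?_) ?_
    · rw [← himg]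
      exact image_mono inter_subset_left
    · calc volume (ball (0 : ι → ℝ) R)
          = volume ((fun x => x + t • g x) '' D ∪
              (fun x => x + t • g x) '' (ball (0 : ι → ℝ) R \ D)) := by
            rw [← image_union, union_sdiff_cancel inter_subset_left, himg]
        _ ≤ _ := measure_union_le _ _
        _ = volume ((fun x => x + t • g x) '' D) := by
            have hz : volume ((fun x => x + t • g x) '' (ball (0 : ι → ℝ) R \ D)) = 0 :=
              (LipschitzWith.id.add htg).volume_image_eq_zero hnull
            rw [hz, add_zero]
  have habs : ∀ x, |(1 + t • fderiv ℝ g x).det| = (1 + t • fderiv ℝ g x).det :=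
    fun x => abs_of_pos (hpos x)
  constructor
  · have := (integrableOn_image_iff_integrableOn_abs_det_fderiv_smul volume hDm hderiv
      hbij.1.injOn (fun _ => (1 : ℝ))).1 (integrableOn_const (by
        rw [hvol]; exact measure_ball_lt_top.ne))
    simpa only [habs, smul_eq_mul, mul_one] using this
  · have := integral_image_eq_integral_abs_det_fderiv_smul volume hDm hderiv
      hbij.1.injOn (fun _ => (1 : ℝ))
    simp only [habs, smul_eq_mul, mul_one, integral_const, measureReal_restrict_apply_univ] at this
    rw [← this, measureReal_def, measureReal_def, hvol]

/-- There is no Lipschitz retraction of a sup norm ball onto its boundary. -/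
theorem not_forall_norm_add_eq_of_lipschitzWith {ι : Type*} [Fintype ι] [Nonempty ι] {K : ℝ≥0}
    {R : ℝ} (hR : 0 < R) {g : (ι → ℝ) → (ι → ℝ)} (hg : LipschitzWith K g)
    (h0 : ∀ x, R ≤ ‖x‖ → g x = 0) : ¬ ∀ x, ‖x‖ ≤ R → ‖x + g x‖ = R := by
  intro hnorm
  obtain ⟨ε, hε, hdetpos⟩ := exists_pos_forall_det_one_add_pos ι
  have hK1 : (0 : ℝ) < K + 1 := by positivity
  obtain ⟨t, w, ht, hw, hdet⟩ :=
    exists_weights_det_one_add (ι := ι) (ε := min 1 ε / (K + 1)) (by positivity)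
  have htK : ∀ j, t j * K < min 1 ε := fun j => by
    have h1 := (lt_div_iff₀ hK1).1 (ht j).2
    nlinarith [(ht j).1]
  have key := fun j => integral_det_one_add_smul_fderiv hg h0 (ht j).1.le
    ((htK j).trans_le (min_le_left _ _)) fun x => hdetpos _ <| by
      rw [norm_smul, Real.norm_of_nonneg (ht j).1.le]
      exact (mul_le_mul_of_nonneg_left (norm_fderiv_le_of_lipschitz ℝ hg) (ht j).1.le).trans_lt
        ((htK j).trans_le (min_le_right _ _))
  set D : Set (ι → ℝ) := ball 0 R ∩ {x | DifferentiableAt ℝ g x}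
  have hDm : MeasurableSet D := measurableSet_ball.inter (measurableSet_of_differentiableAt ℝ g)
  have hzero : ∀ x ∈ D, ∑ j, w j * (1 + t j • fderiv ℝ g x).det = 0 := by
    intro x hx
    rw [← hdet]
    refine HasFDerivAt.det_eq_zero_of_isLocalMax_norm (h := fun x => x + g x)
      ((hasFDerivAt_id x).add hx.2.hasFDerivAt) ?_
    filter_upwards [isOpen_ball.mem_nhds hx.1] with y hy
    rw [hnorm y (mem_ball_zero_iff.1 hy).le, hnorm x (mem_ball_zero_iff.1 hx.1).le]
  have hint : ∫ x in D, ∑ j, w j * (1 + t j • fderiv ℝ g x).det =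
      volume.real (ball (0 : ι → ℝ) R) := by
    rw [integral_finsetSum _ fun j _ => (key j).1.const_mul (w j)]
    simp_rw [integral_const_mul, (key _).2]
    rw [← Finset.sum_mul, hw, one_mul]
  rw [setIntegral_congr_fun hDm hzero, integral_zero] at hint
  have hvpos : 0 < volume.real (ball (0 : ι → ℝ) R) :=
    ENNReal.toReal_pos (measure_ball_pos volume _ hR).ne' measure_ball_lt_top.ne
  linarith

end Perturbation

/-! ### Clamping to a sup norm ball -/

section Clamp

variable {ι : Type*}

/-- Coordinatewise truncation to `[-R, R]`. -/
def boxClamp (R : ℝ) (z : ι → ℝ) : ι → ℝ := fun i => max (-R) (min R (z i))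

theorem boxClamp_eq_self [Fintype ι] {R : ℝ} {z : ι → ℝ} (hz : ‖z‖ ≤ R) : boxClamp R z = z := by
  ext i
  have h := abs_le.1 ((norm_le_pi_norm z i).trans hz)
  simp [boxClamp, h.1, h.2]

theorem norm_boxClamp_le [Fintype ι] {R : ℝ} (hR : 0 ≤ R) (z : ι → ℝ) : ‖boxClamp R z‖ ≤ R := by
  refine (pi_norm_le_iff_of_nonneg hR).2 fun i => abs_le.2 ⟨le_max_left _ _, ?_⟩
  exact max_le (by linarith) (min_le_left _ _)

theorem norm_boxClamp_eq [Fintype ι] [Nonempty ι] {R : ℝ} (hR : 0 < R) {z : ι → ℝ}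
    (hz : R ≤ ‖z‖) : ‖boxClamp R z‖ = R := by
  refine le_antisymm (norm_boxClamp_le hR.le z) ?_
  by_contra! hlt
  refine hz.not_gt ((pi_norm_lt_iff hR).2 fun i => ?_)
  have h := abs_lt.1 ((norm_le_pi_norm (boxClamp R z) i).trans_lt hlt)
  simp only [boxClamp, lt_max_iff, max_lt_iff, min_lt_iff, lt_min_iff, lt_irrefl, false_or] at h
  exact abs_lt.2 ⟨h.1.2, h.2.2⟩

theorem lipschitzWith_boxClamp [Fintype ι] (R : ℝ) :
    LipschitzWith 1 (boxClamp R : (ι → ℝ) → (ι → ℝ)) :=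
  LipschitzWith.of_dist_le_mul fun x y => by
    rw [NNReal.coe_one, one_mul]
    refine (dist_pi_le_iff dist_nonneg).2 fun i => ?_
    have h := (((LipschitzWith.id (α := ℝ)).const_min R).const_max (-R)).dist_le_mul (x i) (y i)
    rw [NNReal.coe_one, one_mul] at h
    exact h.trans (dist_le_pi_dist x y i)

end Clamp

/-! ### The Brouwer fixed point theorem for the cube -/

section Brouwer

open scoped Manifold

variable {ι : Type*} [Fintype ι]

theorem two_le_norm_add_smul_sub {E : Type*} [NormedAddCommGroup E] [NormedSpace ℝ E] {x y : E}
    {C m : ℝ} (hx : ‖x‖ ≤ 2) (hy : ‖y‖ ≤ 1) (hC2 : 2 ≤ C) (hCm : 7 ≤ C * m) (h2 : m ≤ ‖x - y‖) :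
    2 ≤ ‖x + (C * (2 - ‖x‖)) • (x - y)‖ := by
  have hu : 0 ≤ C * (2 - ‖x‖) := mul_nonneg (by linarith) (by linarith)
  rcases le_total (3 / 2) ‖x‖ with h | h
  · have e : (x + (C * (2 - ‖x‖)) • (x - y)) = (1 + C * (2 - ‖x‖)) • x - (C * (2 - ‖x‖)) • y := by
      simp only [smul_sub, add_smul, one_smul]; abel
    have h1 := norm_sub_norm_le ((1 + C * (2 - ‖x‖)) • x) ((C * (2 - ‖x‖)) • y)
    rw [← e, norm_smul, norm_smul, Real.norm_of_nonneg hu,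
      Real.norm_of_nonneg (by linarith)] at h1
    have h5 : C * (2 - ‖x‖) * ‖y‖ ≤ C * (2 - ‖x‖) := mul_le_of_le_one_right hu hy
    linarith [mul_nonneg (sub_nonneg.2 hx) (sub_nonneg.2 hC2),
      mul_nonneg hu (sub_nonneg.2 h)]
  · have h1 := norm_sub_le ((x + (C * (2 - ‖x‖)) • (x - y))) x
    have e : (x + (C * (2 - ‖x‖)) • (x - y)) - x = (C * (2 - ‖x‖)) • (x - y) := by simp
    rw [e, norm_smul, Real.norm_of_nonneg hu] at h1
    have h3 : C * (2 - ‖x‖) * m ≤ C * (2 - ‖x‖) * ‖x - y‖ :=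
      mul_le_mul_of_nonneg_left h2 hu
    have h4 := mul_le_mul_of_nonneg_left hCm (sub_nonneg.2 hx)
    linarith

theorem LocallyLipschitz.add_smul_sub {E : Type*} [NormedAddCommGroup E] [NormedSpace ℝ E]
    {f : E → E} (hf : LocallyLipschitz f) (C : ℝ) :
    LocallyLipschitz fun x => x + (C * (2 - ‖x‖)) • (x - f x) := by
  have hF : ContDiff ℝ 1 fun p : E × ℝ × E => p.1 + (C * (2 - p.2.1)) • (p.1 - p.2.2) := by
    fun_prop
  exact hF.locallyLipschitz.comp (LocallyLipschitz.id.prodMk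
    (lipschitzWith_one_norm.locallyLipschitz.prodMk hf))

theorem LocallyLipschitz.sub_id {E : Type*} [NormedAddCommGroup E] [NormedSpace ℝ E]
    {f : E → E} (hf : LocallyLipschitz f) : LocallyLipschitz fun x => f x - x := by
  have hF : ContDiff ℝ 1 fun p : E × E => p.1 - p.2 := by fun_prop
  exact hF.locallyLipschitz.comp (hf.prodMk LocallyLipschitz.id)

theorem exists_fixedPoint_of_locallyLipschitz [Nonempty ι] {f : (ι → ℝ) → (ι → ℝ)}
    (hf : LocallyLipschitz f) (hf1 : ∀ x, ‖f x‖ ≤ 1) : ∃ x, f x = x := by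
  by_contra! hne
  obtain ⟨x₀, -, hx₀⟩ := (isCompact_closedBall (0 : ι → ℝ) 2).exists_isMinOn
    ⟨0, by simp⟩ (f := fun x => ‖x - f x‖)
    ((continuous_id.sub hf.continuous).norm.continuousOn)
  obtain ⟨C, hC2, hCm⟩ : ∃ C : ℝ, 2 ≤ C ∧ 7 ≤ C * ‖x₀ - f x₀‖ := by
    have hm : 0 < ‖x₀ - f x₀‖ := norm_pos_iff.2 (sub_ne_zero.2 (hne x₀).symm)
    refine ⟨2 + 7 / ‖x₀ - f x₀‖, by simp only [le_add_iff_nonneg_right]; positivity, ?_⟩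
    rw [add_mul, div_mul_cancel₀ _ hm.ne']
    linarith
  obtain ⟨H, hH⟩ : ∃ H : (ι → ℝ) → (ι → ℝ), ∀ x, H x = x + (C * (2 - ‖x‖)) • (x - f x) :=
    ⟨_, fun _ => rfl⟩
  have hHnorm : ∀ x, ‖x‖ ≤ 2 → 2 ≤ ‖H x‖ := fun x hx =>
    hH x ▸ two_le_norm_add_smul_sub hx (hf1 x) hC2 hCm (hx₀ (by simpa using hx))
  have hHlip : LocallyLipschitz H := funext hH ▸ hf.add_smul_sub C
  have hHid : ∀ x, ‖x‖ = 2 → H x = x := fun x hx => by simp [hH, hx]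
  have hg₀ : LocallyLipschitz fun x => boxClamp 2 (H x) - x :=
    ((lipschitzWith_boxClamp 2).locallyLipschitz.comp hHlip).sub_id
  obtain ⟨K, hK⟩ := (hg₀.locallyLipschitzOn (s := closedBall 0 2)).exists_lipschitzOnWith_of_compact
    (isCompact_closedBall _ _)
  have hg : LipschitzWith (K * 1) fun x : ι → ℝ =>
      boxClamp 2 (H (boxClamp 2 x)) - boxClamp 2 x := by
    rw [← lipschitzOnWith_univ]
    refine hK.comp ((lipschitzWith_boxClamp 2).lipschitzOnWith) fun x _ => ?_
    simpa using norm_boxClamp_le zero_le_two x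
  refine not_forall_norm_add_eq_of_lipschitzWith zero_lt_two hg (fun x hx => ?_) fun x hx => ?_
  · have h2 := norm_boxClamp_eq zero_lt_two hx
    rw [hHid _ h2, boxClamp_eq_self h2.le, sub_self]
  · rw [boxClamp_eq_self hx, add_sub_cancel]
    exact norm_boxClamp_eq zero_lt_two (hHnorm x hx)

theorem exists_contDiff_norm_sub_lt {E F : Type*} [NormedAddCommGroup E] [NormedSpace ℝ E]
    [FiniteDimensional ℝ E] [NormedAddCommGroup F] [NormedSpace ℝ F] {f : E → F}
    (hf : Continuous f) {ε : ℝ} (hε : 0 < ε) :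
    ∃ g : E → F, ContDiff ℝ 1 g ∧ ∀ x, ‖g x - f x‖ < ε := by
  obtain ⟨g, hg⟩ := exists_contMDiffMap_forall_mem_convex_of_local_const (n := 1) 𝓘(ℝ, E)
    (t := fun x => ball (f x) ε) (fun x => convex_ball _ _) fun x => ⟨f x, by
      filter_upwards [hf.continuousAt.eventually (ball_mem_nhds (f x) hε)] with y hy
      exact mem_ball_comm.1 hy⟩
  exact ⟨g, g.contMDiff.contDiff, fun x => mem_ball_iff_norm.1 (hg x)⟩

theorem exists_fixedPoint_of_continuous [Nonempty ι] {f : (ι → ℝ) → (ι → ℝ)}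
    (hf : Continuous f) (hf1 : ∀ x, ‖f x‖ ≤ 1) : ∃ x, f x = x := by
  by_contra! hne
  obtain ⟨x₀, -, hx₀⟩ := (isCompact_closedBall (0 : ι → ℝ) 1).exists_isMinOn
    ⟨0, by simp⟩ (f := fun x => ‖x - f x‖) ((continuous_id.sub hf).norm.continuousOn)
  obtain ⟨g, hg, hgf⟩ := exists_contDiff_norm_sub_lt hf
    (norm_pos_iff.2 (sub_ne_zero.2 (hne x₀).symm))
  obtain ⟨x, hx⟩ := exists_fixedPoint_of_locallyLipschitz
    ((lipschitzWith_boxClamp 1).locallyLipschitz.comp hg.locallyLipschitz)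
    fun x => norm_boxClamp_le zero_le_one (g x)
  have hx1 : ‖x‖ ≤ 1 := hx ▸ norm_boxClamp_le zero_le_one (g x)
  have h1 : ‖x₀ - f x₀‖ ≤ ‖x - f x‖ := hx₀ (by simpa using hx1)
  have h2 := (lipschitzWith_boxClamp 1).dist_le_mul (g x) (f x)
  have hx' : boxClamp 1 (g x) = x := hx
  rw [hx', boxClamp_eq_self (hf1 x), NNReal.coe_one, one_mul, dist_eq_norm, dist_eq_norm] at h2
  exact (h1.trans h2).not_gt (hgf x)

/-- **Brouwer fixed point theorem** for a cube. -/
theorem exists_fixedPoint_of_continuousOn_closedBall [Nonempty ι] {a : ℝ} (ha : 0 < a)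
    {f : (ι → ℝ) → (ι → ℝ)} (hf : ContinuousOn f (closedBall 0 a))
    (hmaps : MapsTo f (closedBall 0 a) (closedBall 0 a)) : ∃ x ∈ closedBall 0 a, f x = x := by
  have hmem : ∀ x : ι → ℝ, a • boxClamp 1 x ∈ closedBall (0 : ι → ℝ) a := fun x => by
    rw [mem_closedBall_zero_iff, norm_smul, Real.norm_of_nonneg ha.le]
    exact mul_le_of_le_one_right ha.le (norm_boxClamp_le zero_le_one x)
  have hcont : Continuous fun x : ι → ℝ => a⁻¹ • f (a • boxClamp 1 x) :=
    (hf.comp_continuous ((lipschitzWith_boxClamp 1).continuous.const_smul a) hmem).const_smul a⁻¹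
  have hle : ∀ x : ι → ℝ, ‖a⁻¹ • f (a • boxClamp 1 x)‖ ≤ 1 := fun x => by
    rw [norm_smul, Real.norm_of_nonneg (inv_nonneg.2 ha.le), inv_mul_le_iff₀ ha, mul_one]
    simpa using hmaps (hmem x)
  obtain ⟨x, hx⟩ := exists_fixedPoint_of_continuous hcont hle
  have hx1 : boxClamp 1 x = x := boxClamp_eq_self (hx ▸ hle x)
  refine ⟨a • x, hx1 ▸ hmem x, ?_⟩
  rw [hx1] at hx
  rw [← inv_smul_eq_iff₀ ha.ne', hx]

end Brouwer

theorem brouwer_cube_image (d : ℕ) (hd : 1 ≤ d)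
    (v : OrthonormalBasis (Fin d) ℝ (EuclideanSpace ℝ (Fin d)))
    (x₀ : EuclideanSpace ℝ (Fin d)) (a lam δ : ℝ)
    (ha : 0 < a) (hlam : 0 < lam) (hδ : 0 ≤ δ) (hδ' : δ < a * lam)
    (P : (Fin d → ℝ) → EuclideanSpace ℝ (Fin d))
    (hP : ContinuousOn P {t | ∀ i, |t i| ≤ a})
    (hclose : ∀ t ∈ {t : Fin d → ℝ | ∀ i, |t i| ≤ a},
      ‖P t - (x₀ + ∑ i, (t i * lam) • v i)‖ ≤ δ) :
    closedBall x₀ (a * lam - δ) ⊆ P '' {t | ∀ i, |t i| ≤ a} := by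
  have : Nonempty (Fin d) := ⟨⟨0, hd⟩⟩
  have hcube : {t : Fin d → ℝ | ∀ i, |t i| ≤ a} = closedBall 0 a := by
    ext t
    simp [pi_norm_le_iff_of_nonneg ha.le]
  rw [hcube] at hP hclose ⊢
  intro y hy
  rw [mem_closedBall, dist_eq_norm] at hy
  let f : (Fin d → ℝ) → (Fin d → ℝ) := fun t i => t i - lam⁻¹ * inner ℝ (v i) (P t - y)
  have hf : ContinuousOn f (closedBall 0 a) := by
    refine continuousOn_pi.2 fun i => (continuous_apply i).continuousOn.sub ?_
    exact continuousOn_const.mul (continuousOn_const.inner (hP.sub continuousOn_const))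
  have hmaps : MapsTo f (closedBall 0 a) (closedBall 0 a) := by
    intro t ht
    refine mem_closedBall_zero_iff.2 ((pi_norm_le_iff_of_nonneg ha.le).2 fun i => ?_)
    have hsum : inner ℝ (v i) (∑ j, (t j * lam) • v j) = t i * lam := by
      simpa using v.orthonormal.inner_right_fintype (fun j => t j * lam) i
    have e : f t i = lam⁻¹ *
        inner ℝ (v i) ((y - x₀) - (P t - (x₀ + ∑ j, (t j * lam) • v j))) := by
      have : (y - x₀) - (P t - (x₀ + ∑ j, (t j * lam) • v j)) =
          (∑ j, (t j * lam) • v j) - (P t - y) := by abel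
      rw [this, inner_sub_right, hsum]
      simp only [f]
      field_simp
    have h1 := norm_inner_le_norm (𝕜 := ℝ) (v i)
      ((y - x₀) - (P t - (x₀ + ∑ j, (t j * lam) • v j)))
    rw [v.orthonormal.1 i, one_mul] at h1
    have h2 := norm_sub_le (y - x₀) (P t - (x₀ + ∑ j, (t j * lam) • v j))
    rw [e, norm_mul, Real.norm_of_nonneg (inv_nonneg.2 hlam.le), inv_mul_le_iff₀ hlam]
    linarith [hclose t ht]
  obtain ⟨t, ht, hfix⟩ := exists_fixedPoint_of_continuousOn_closedBall ha hf hmaps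
  refine ⟨t, ht, sub_eq_zero.1 (v.repr.map_eq_zero_iff.1 (PiLp.ext fun i => ?_))⟩
  have h := congrFun hfix i
  have h' : lam⁻¹ * inner ℝ (v i) (P t - y) = 0 := by
    simp only [f] at h
    linarith
  rw [v.repr_apply_apply]
  exact (mul_eq_zero.1 h').resolve_left (inv_ne_zero hlam.ne')
end

section
/- Let d ≥ 1, let v ∈ ℝ^d be a unit vector, let z ∈ ℝ^d, let ε > 0 and a > 0, and let H : [−a, a] × closedBall(z, ε) → ℝ^d be a continuous map satisfying ‖H(t, y) − (y + t·v)‖ ≤ ε/2 for every (t, y) in its domain. Then every point of the form y + t·v with y ∈ closedBall(z, ε/2) and t ∈ [−a, a] lies in the image of H. -/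
open Metric Set

/-- The radial projection of a normed space onto its closed unit ball. -/
noncomputable def radialProj {E : Type*} [NormedAddCommGroup E] [NormedSpace ℝ E] (x : E) : E :=
  (max 1 ‖x‖)⁻¹ • x

section RadialProj

variable {E : Type*} [NormedAddCommGroup E] [NormedSpace ℝ E]

lemma radialProj_of_norm_le_one {x : E} (hx : ‖x‖ ≤ 1) : radialProj x = x := by
  simp [radialProj, max_eq_left hx]

lemma norm_radialProj_of_one_le {x : E} (hx : 1 ≤ ‖x‖) : ‖radialProj x‖ = 1 := by
  have : ‖x‖ ≠ 0 := by positivity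
  simp [radialProj, max_eq_right hx, norm_smul, this]

lemma norm_radialProj_le_one (x : E) : ‖radialProj x‖ ≤ 1 := by
  rcases le_total ‖x‖ 1 with hx | hx
  · rwa [radialProj_of_norm_le_one hx]
  · exact (norm_radialProj_of_one_le hx).le

lemma lipschitzWith_radialProj : LipschitzWith 2 (radialProj : E → E) := by
  refine LipschitzWith.of_dist_le_mul fun x y => ?_
  rw [dist_eq_norm, dist_eq_norm]
  unfold radialProj
  set a := max 1 ‖x‖ with ha
  set b := max 1 ‖y‖ with hb
  have ha1 : 1 ≤ a := le_max_left _ _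
  have hb1 : 1 ≤ b := le_max_left _ _
  have hyb : ‖y‖ ≤ b := le_max_right _ _
  have hba : |b - a| ≤ ‖x - y‖ := by
    have h1 : |b - a| ≤ |‖y‖ - ‖x‖| := by
      simpa using abs_max_sub_max_le_max 1 ‖y‖ 1 ‖x‖
    rw [norm_sub_rev]
    exact h1.trans (abs_norm_sub_norm_le y x)
  have key : a⁻¹ • x - b⁻¹ • y = a⁻¹ • (x - y) + (a⁻¹ - b⁻¹) • y := by
    module
  have hab : |a⁻¹ - b⁻¹| = a⁻¹ * b⁻¹ * |b - a| := by
    have : a⁻¹ - b⁻¹ = a⁻¹ * b⁻¹ * (b - a) := by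
      field_simp
    rw [this, abs_mul, abs_of_pos (by positivity)]
  have ha2 : a⁻¹ ≤ 1 := inv_le_one_of_one_le₀ ha1
  have h1 : ‖a⁻¹ • (x - y)‖ ≤ ‖x - y‖ := by
    rw [norm_smul, Real.norm_of_nonneg (by positivity)]
    exact mul_le_of_le_one_left (norm_nonneg _) ha2
  have h2 : ‖(a⁻¹ - b⁻¹) • y‖ ≤ ‖x - y‖ := by
    rw [norm_smul, Real.norm_eq_abs, hab]
    calc a⁻¹ * b⁻¹ * |b - a| * ‖y‖ = a⁻¹ * (b⁻¹ * ‖y‖) * |b - a| := by ring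
      _ ≤ 1 * 1 * |b - a| := by
        gcongr
        rw [inv_mul_le_iff₀ (by positivity)]; simpa using hyb
      _ ≤ ‖x - y‖ := by simpa using hba
  rw [key]
  calc _ ≤ ‖a⁻¹ • (x - y)‖ + ‖(a⁻¹ - b⁻¹) • y‖ := norm_add_le _ _
    _ ≤ _ := by push_cast; linarith

end RadialProj

section Det

variable {E : Type*} [NormedAddCommGroup E] [NormedSpace ℝ E] [FiniteDimensional ℝ E]

lemma exists_polynomial_eval_eq_det_one_add_smul (A : E →L[ℝ] E) :
    ∃ p : Polynomial ℝ, p.natDegree ≤ Module.finrank ℝ E ∧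
      ∀ t : ℝ, p.eval t = (1 + t • A).det := by
  classical
  let b := Module.finBasis ℝ E
  let M := LinearMap.toMatrix b b (A : E →ₗ[ℝ] E)
  refine ⟨((Polynomial.X : Polynomial ℝ) • M.map Polynomial.C
    + (1 : Matrix _ _ ℝ).map Polynomial.C).det, ?_, fun t => ?_⟩
  · simpa using Polynomial.natDegree_det_X_add_C_le M 1
  · rw [← Polynomial.coe_evalRingHom, RingHom.map_det, ContinuousLinearMap.det,
      ← LinearMap.det_toMatrix b]
    congr 1
    ext i j
    simp [M, LinearMap.toMatrix_apply, Matrix.one_apply, add_comm, Finsupp.single_apply,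
      eq_comm, apply_ite (Polynomial.eval t), mul_comm t]

lemma det_one_add_smul_pos {A : E →L[ℝ] E} {t C : ℝ} (hA : ‖A‖ ≤ C) (ht : 0 ≤ t)
    (htC : t * C < 1) : 0 < (1 + t • A).det := by
  by_contra! hneg
  have hmem : (0 : ℝ) ∈ (fun s : ℝ => (1 + s • A).det) '' Icc 0 t := by
    refine intermediate_value_Icc' ht
      (ContinuousLinearMap.continuous_det.comp (by fun_prop)).continuousOn ⟨hneg, ?_⟩
    simp [ContinuousLinearMap.det]
  obtain ⟨s, hs, hdet⟩ := hmem
  obtain ⟨w, hw, hw0⟩ := Submodule.exists_mem_ne_zero_of_ne_bot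
    (LinearMap.bot_lt_ker_of_det_eq_zero hdet).ne'
  have hw' : w + s • A w = 0 := by simpa using hw
  have h1 : ‖w‖ ≤ s * (C * ‖w‖) := by
    calc ‖w‖ = s * ‖A w‖ := by
          nth_rewrite 1 [eq_neg_of_add_eq_zero_left hw']
          rw [norm_neg, norm_smul, Real.norm_of_nonneg hs.1]
      _ ≤ s * (C * ‖w‖) := mul_le_mul_of_nonneg_left (A.le_of_opNorm_le hA w) hs.1
  have hC : 0 ≤ C := (norm_nonneg _).trans hA
  have h2 : s * C ≤ t * C := by gcongr; exact hs.2
  have : 0 < ‖w‖ := norm_pos_iff.2 hw0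
  nlinarith

end Det

open MeasureTheory in
/-- There is no `C¹` retraction of the closed unit ball onto the unit sphere. -/
theorem not_exists_contDiff_retraction {E : Type*} [NormedAddCommGroup E] [InnerProductSpace ℝ E]
    [FiniteDimensional ℝ E] (g : E → E) (hg : ∀ x, ‖x‖ ≤ 1 → ContDiffAt ℝ 1 g x)
    (hg1 : ∀ x, ‖x‖ ≤ 1 → ‖g x‖ = 1) (hgs : ∀ x, ‖x‖ = 1 → g x = x) : False := by
  borelize E
  set h : E → E := fun x => g x - x with hh
  have hhc : ∀ x, ‖x‖ ≤ 1 → ContDiffAt ℝ 1 h x := fun x hx => (hg x hx).sub contDiffAt_id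
  obtain ⟨K, hK⟩ : ∃ K, LipschitzOnWith K h (closedBall 0 1) :=
    ContDiffOn.exists_lipschitzOnWith (n := 1)
      (fun x hx => (hhc x (by simpa using hx)).contDiffWithinAt) one_ne_zero
      (convex_closedBall _ _) (isCompact_closedBall _ _)
  set k : E → E := h ∘ radialProj with hk
  have hkL : LipschitzWith (K * 2) k := by
    rw [← lipschitzOnWith_univ]
    exact hK.comp lipschitzWith_radialProj.lipschitzOnWith
      (fun x _ => by simpa using norm_radialProj_le_one x)
  have hkin : ∀ x, ‖x‖ ≤ 1 → k x = h x := fun x hx => by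
    simp [hk, radialProj_of_norm_le_one hx]
  have hkout : ∀ x, 1 ≤ ‖x‖ → k x = 0 := fun x hx => by
    simp [hk, hh, hgs _ (norm_radialProj_of_one_le hx)]
  set A : E → E →L[ℝ] E := fun x => fderiv ℝ h x with hA
  have hAK : ∀ x ∈ ball (0 : E) 1, ‖A x‖ ≤ (K * 2 : NNReal) := fun x hx => by
    refine (norm_fderiv_le_of_lipschitzOn ℝ (isOpen_ball.mem_nhds hx)
      (hK.mono ball_subset_closedBall)).trans ?_
    push_cast
    linarith [K.2]
  have hderiv : ∀ t : ℝ, ∀ x ∈ ball (0 : E) 1,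
      HasFDerivAt (fun x => x + t • h x) (1 + t • A x) x := fun t x hx =>
    (hasFDerivAt_id x).add
      ((((hhc x (by simpa using (mem_ball_zero_iff.1 hx).le)).differentiableAt
        one_ne_zero).hasFDerivAt).const_smul t)
  have hint : ∀ t : ℝ, IntegrableOn (fun x => (1 + t • A x).det) (ball (0 : E) 1) := fun t => by
    refine IntegrableOn.mono_set (t := closedBall (0 : E) 1) ?_ ball_subset_closedBall
    refine ContinuousOn.integrableOn_compact (isCompact_closedBall _ _) ?_
    refine ContinuousLinearMap.continuous_det.comp_continuousOn ?_
    refine continuousOn_const.add (ContinuousOn.const_smul ?_ t)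
    exact fun x hx => ((hhc x (by simpa using hx)).continuousAt_fderiv
      one_ne_zero).continuousWithinAt
  have hvol : ∀ t : ℝ, 0 ≤ t → t < 1 → t * (K * 2 : NNReal) < 1 →
      ∫ x in ball (0 : E) 1, (1 + t • A x).det = volume.real (ball (0 : E) 1) := by
    intro t ht0 ht1 htK
    obtain ⟨T, hT⟩ : ∃ T : NNReal, (T : ℝ) = t := ⟨⟨t, ht0⟩, rfl⟩
    have htL : LipschitzWith (T * (K * 2)) (fun x => t • k x) := by
      refine LipschitzWith.of_dist_le_mul fun x y => ?_
      rw [dist_smul₀, Real.norm_of_nonneg ht0, NNReal.coe_mul, hT, mul_assoc]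
      exact mul_le_mul_of_nonneg_left (hkL.dist_le_mul x y) ht0
    have hlt : (T * (K * 2) : NNReal) < 1 := by
      rw [← NNReal.coe_lt_coe, NNReal.coe_mul, hT]; exact htK
    have himg : (fun x => x + t • h x) '' ball (0 : E) 1 = ball 0 1 := by
      apply Subset.antisymm
      · rintro _ ⟨x, hx, rfl⟩
        rw [mem_ball_zero_iff] at hx ⊢
        have : x + t • h x = (1 - t) • x + t • g x := by simp only [hh]; module
        simp only [this]
        calc _ ≤ ‖(1 - t) • x‖ + ‖t • g x‖ := norm_add_le _ _
          _ = (1 - t) * ‖x‖ + t := by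
            rw [norm_smul, norm_smul, hg1 x hx.le, Real.norm_of_nonneg ht0,
              Real.norm_of_nonneg (by linarith), mul_one]
          _ < 1 := by nlinarith
      · intro y hy
        have hc : ContractingWith (T * (K * 2)) (fun x => y - t • k x) := by
          refine ⟨hlt, ?_⟩
          simpa using (LipschitzWith.const y).sub htL
        obtain ⟨x, hx, -⟩ := hc.exists_fixedPoint 0 (edist_ne_top _ _)
        have hx' : x + t • k x = y := by
          have : y - t • k x = x := hx
          exact (sub_eq_iff_eq_add.1 this).symm
        have hxb : x ∈ ball (0 : E) 1 := by
          by_contra hxb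
          have h1 : 1 ≤ ‖x‖ := by simpa using hxb
          rw [hkout x h1, smul_zero, add_zero] at hx'
          exact hxb (hx' ▸ hy)
        refine ⟨x, hxb, ?_⟩
        rw [← hx', hkin x (mem_ball_zero_iff.1 hxb).le]
    have hinj : InjOn (fun x => x + t • h x) (ball (0 : E) 1) := by
      intro x hx y hy hxy
      have hx1 := hkin x (mem_ball_zero_iff.1 hx).le
      have hy1 := hkin y (mem_ball_zero_iff.1 hy).le
      have heq : x - y = t • k y - t • k x := by
        rw [hx1, hy1, sub_eq_sub_iff_add_eq_add]
        exact hxy.trans (add_comm _ _)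
      have h1 := htL.dist_le_mul y x
      rw [dist_eq_norm, ← heq, ← dist_eq_norm, dist_comm y x] at h1
      have h2 : ((T * (K * 2) : NNReal) : ℝ) < 1 := by exact_mod_cast hlt
      have h3 := dist_nonneg (x := x) (y := y)
      exact dist_le_zero.1 (by nlinarith)
    have hcv := integral_image_eq_integral_abs_det_fderiv_smul volume
      (measurableSet_ball (x := (0 : E)) (ε := 1))
      (fun x hx => (hderiv t x hx).hasFDerivWithinAt) hinj (fun _ => (1 : ℝ))
    rw [himg] at hcv
    rw [setIntegral_const] at hcv
    simp only [smul_eq_mul, mul_one] at hcv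
    rw [hcv]
    exact setIntegral_congr_fun measurableSet_ball fun x hx =>
      (abs_of_pos (det_one_add_smul_pos (hAK x hx) ht0 htK)).symm
  have hzero : ∀ x ∈ ball (0 : E) 1, (1 + (1 : ℝ) • A x).det = 0 := by
    intro x hx
    have hx1 : ‖x‖ < 1 := mem_ball_zero_iff.1 hx
    have hd : HasFDerivAt g (1 + (1 : ℝ) • A x) x := by
      have := hderiv 1 x hx
      simpa [hh] using this
    have hsq : HasFDerivAt (fun y => inner ℝ (g y) (g y)) (0 : E →L[ℝ] ℝ) x := by
      refine (hasFDerivAt_const (1 : ℝ) x).congr_of_eventuallyEq ?_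
      filter_upwards [isOpen_ball.mem_nhds hx] with y hy
      rw [real_inner_self_eq_norm_sq, hg1 y (mem_ball_zero_iff.1 hy).le, one_pow]
    have huniq := hsq.unique (hd.inner ℝ hd)
    by_contra hne
    obtain ⟨w, hw⟩ : ∃ w, (1 + (1 : ℝ) • A x) w = g x := by
      have := (LinearMap.equivOfDetNeZero ((1 + (1 : ℝ) • A x : E →L[ℝ] E) : E →ₗ[ℝ] E) hne).surjective
        (g x)
      exact this
    have h1 := DFunLike.congr_fun huniq w
    simp only [ContinuousLinearMap.comp_apply, ContinuousLinearMap.prod_apply, hw,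
      fderivInnerCLM_apply, real_inner_self_eq_norm_sq, hg1 x hx1.le] at h1
    norm_num at h1
  set n := Module.finrank ℝ E
  obtain ⟨τ, hτ0, hτ1, hτK⟩ : ∃ τ : ℝ, 0 < τ ∧ τ < 1 ∧ τ * (K * 2 : NNReal) < 1 := by
    have hK0 : (0 : ℝ) ≤ (K * 2 : NNReal) := NNReal.coe_nonneg _
    refine ⟨1 / ((K * 2 : NNReal) + 2), by positivity, ?_, ?_⟩
    · rw [div_lt_one (by positivity)]; linarith
    · rw [div_mul_eq_mul_div, div_lt_one (by positivity)]; linarith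
  let node : ℕ → ℝ := fun i => τ / (i + 1)
  have hnode : InjOn node (Finset.range (n + 1) : Finset ℕ) := by
    intro i _ j _ hij
    have h1 : τ / ((i : ℝ) + 1) = τ / (j + 1) := hij
    rw [div_eq_div_iff (by positivity) (by positivity)] at h1
    have := mul_left_cancel₀ hτ0.ne' h1
    exact_mod_cast (add_right_cancel this).symm
  have hnode_le : ∀ i, 0 ≤ node i ∧ node i ≤ τ := fun i =>
    ⟨by positivity, div_le_self hτ0.le (by linarith [(Nat.cast_nonneg i : (0 : ℝ) ≤ i)])⟩
  let c : ℕ → ℝ := fun i => (Lagrange.basis (Finset.range (n + 1)) node i).eval 1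
  have hinterp : ∀ p : Polynomial ℝ, p.natDegree ≤ n →
      p.eval 1 = ∑ i ∈ Finset.range (n + 1), p.eval (node i) * c i := by
    intro p hp
    have hdeg : p.degree < (Finset.range (n + 1)).card := by
      rw [Finset.card_range]
      exact (Polynomial.degree_le_natDegree).trans_lt (by exact_mod_cast Nat.lt_succ_of_le hp)
    conv_lhs => rw [Lagrange.eq_interpolate hnode hdeg]
    simp [Lagrange.interpolate_apply, Polynomial.eval_finsetSum, c]
  have hcsum : ∑ i ∈ Finset.range (n + 1), c i = 1 := by
    simpa using (hinterp 1 (by simp)).symm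
  have hdet : ∀ x, (1 + (1 : ℝ) • A x).det
      = ∑ i ∈ Finset.range (n + 1), (1 + node i • A x).det * c i := by
    intro x
    obtain ⟨p, hp, hpe⟩ := exists_polynomial_eval_eq_det_one_add_smul (A x)
    simpa only [hpe] using hinterp p hp
  have hfinal : ∫ x in ball (0 : E) 1, (1 + (1 : ℝ) • A x).det
      = volume.real (ball (0 : E) 1) := by
    simp only [hdet]
    rw [integral_finsetSum _ fun i _ => (hint (node i)).mul_const _]
    have : ∀ i ∈ Finset.range (n + 1), ∫ x in ball (0 : E) 1, (1 + node i • A x).det * c i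
        = volume.real (ball (0 : E) 1) * c i := by
      intro i _
      obtain ⟨h0, h1⟩ := hnode_le i
      rw [integral_mul_const, hvol _ h0 (h1.trans_lt hτ1)
        ((mul_le_mul_of_nonneg_right h1 (NNReal.coe_nonneg _)).trans_lt hτK)]
    rw [Finset.sum_congr rfl this, ← Finset.mul_sum, hcsum, mul_one]
  rw [setIntegral_congr_fun measurableSet_ball hzero] at hfinal
  have hpos : 0 < volume.real (ball (0 : E) 1) :=
    ENNReal.toReal_pos (measure_ball_pos _ _ one_pos).ne' measure_ball_lt_top.ne
  simp at hfinal
  linarith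

/-- A `C¹` map into the closed unit ball has a fixed point. -/
theorem exists_fixedPoint_of_contDiff {E : Type*} [NormedAddCommGroup E] [InnerProductSpace ℝ E]
    [FiniteDimensional ℝ E] {f : E → E} (hf : ContDiff ℝ 1 f) (hf1 : ∀ x, ‖f x‖ ≤ 1) :
    ∃ x, f x = x := by
  by_contra! hne
  set u : E → E := fun x => x - f x with hu
  have hu0 : ∀ x, 0 < ‖u x‖ ^ 2 := fun x => by
    have : u x ≠ 0 := sub_ne_zero.2 (hne x).symm
    positivity
  have huc : ContDiff ℝ 1 u := contDiff_id.sub hf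
  have hsphere : ∀ x, ‖x‖ = 1 → 0 < inner ℝ x (u x) := fun x hx => by
    have h1 : ‖u x‖ ^ 2 = ‖x‖ ^ 2 - 2 * inner ℝ x (f x) + ‖f x‖ ^ 2 := norm_sub_sq_real x (f x)
    have h2 : inner ℝ x (u x) = ‖x‖ ^ 2 - inner ℝ x (f x) := by
      simp only [hu, inner_sub_right, real_inner_self_eq_norm_sq]
    have h3 := hf1 x
    have h4 := norm_nonneg (f x)
    have h5 := hu0 x
    rw [hx] at h1 h2
    nlinarith
  set D : E → ℝ := fun x => inner ℝ x (u x) ^ 2 + ‖u x‖ ^ 2 * (1 - ‖x‖ ^ 2) with hD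
  have hDpos : ∀ x, ‖x‖ ≤ 1 → 0 < D x := fun x hx => by
    rcases hx.lt_or_eq with hx | hx
    · have : 0 < 1 - ‖x‖ ^ 2 := by nlinarith [norm_nonneg x]
      have := mul_pos (hu0 x) this
      simp only [hD]
      positivity
    · have := hsphere x hx
      simp only [hD, hx]
      nlinarith
  have hDc : ContDiff ℝ 1 D :=
    ((contDiff_id.inner ℝ huc).pow 2).add
      ((huc.norm_sq ℝ).mul (contDiff_const.sub (contDiff_id.norm_sq ℝ)))
  set s : E → ℝ := fun x => (-inner ℝ x (u x) + √(D x)) / ‖u x‖ ^ 2 with hs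
  refine not_exists_contDiff_retraction (fun x => x + s x • u x) ?_ ?_ ?_
  · intro x hx
    refine contDiffAt_id.add (ContDiffAt.smul ?_ huc.contDiffAt)
    exact ((contDiff_id.inner ℝ huc).neg.contDiffAt.add
      (hDc.contDiffAt.sqrt (hDpos x hx).ne')).div (huc.norm_sq ℝ).contDiffAt (hu0 x).ne'
  · intro x hx
    have hsq : √(D x) ^ 2 = D x := Real.sq_sqrt (hDpos x hx).le
    have h1 : ‖x + s x • u x‖ ^ 2 = 1 := by
      rw [norm_add_sq_real, norm_smul, inner_smul_right, mul_pow, Real.norm_eq_abs, sq_abs]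
      have hne' := (hu0 x).ne'
      have hsu : s x * ‖u x‖ ^ 2 = -inner ℝ x (u x) + √(D x) := by
        exact div_mul_cancel₀ _ hne'
      have h2 : (s x * ‖u x‖ ^ 2 + inner ℝ x (u x)) ^ 2 = D x := by
        rw [hsu, neg_add_cancel_comm, hsq]
      have h3 : ‖u x‖ ^ 2 * (‖x‖ ^ 2 + 2 * (s x * inner ℝ x (u x)) + s x ^ 2 * ‖u x‖ ^ 2)
          = ‖u x‖ ^ 2 * 1 := by
        simp only [hD] at h2
        linarith
      exact mul_left_cancel₀ hne' h3
    exact (pow_eq_one_iff_of_nonneg (norm_nonneg _) two_ne_zero).1 h1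
  · intro x hx
    have : s x = 0 := by
      simp only [hs, hD, hx]
      simp [Real.sqrt_sq (hsphere x hx).le]
    simp [this]

open scoped Manifold in
/-- **Brouwer's fixed point theorem** for the closed unit ball of a Euclidean space. -/
theorem exists_fixedPoint_of_continuousOn_closedBall_s8 {E : Type*} [NormedAddCommGroup E]
    [InnerProductSpace ℝ E] [FiniteDimensional ℝ E] {f : E → E}
    (hf : ContinuousOn f (closedBall 0 1)) (hf1 : MapsTo f (closedBall 0 1) (closedBall 0 1)) :
    ∃ x ∈ closedBall (0 : E) 1, f x = x := by
  by_contra! hne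
  obtain ⟨x₀, hx₀, hmin⟩ := (isCompact_closedBall (0 : E) 1).exists_isMinOn
    ⟨0, by simp⟩ (hf.sub continuousOn_id).norm
  set δ := ‖f x₀ - x₀‖ with hδ
  have hδ0 : 0 < δ := norm_pos_iff.2 (sub_ne_zero.2 (hne x₀ hx₀))
  have hproj : ∀ x : E, radialProj x ∈ closedBall (0 : E) 1 := fun x => by
    simpa using norm_radialProj_le_one x
  have hFc : Continuous (f ∘ radialProj) :=
    hf.comp_continuous lipschitzWith_radialProj.continuous hproj
  obtain ⟨φ, hφ⟩ := exists_contMDiffMap_forall_mem_convex_of_local_const (n := 1) 𝓘(ℝ, E)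
    (t := fun x : E => closedBall (0 : E) 1 ∩ ball ((f ∘ radialProj) x) δ)
    (fun x => (convex_closedBall _ _).inter (convex_ball _ _))
    (fun x => ⟨f (radialProj x), by
      have : ∀ᶠ y in nhds x, dist ((f ∘ radialProj) y) ((f ∘ radialProj) x) < δ :=
        hFc.continuousAt.eventually (ball_mem_nhds _ hδ0)
      filter_upwards [this] with y hy
      exact ⟨hf1 (hproj x), by rw [mem_ball, dist_comm]; exact hy⟩⟩)
  have hφ1 : ∀ x, ‖φ x‖ ≤ 1 := fun x => by simpa using (hφ x).1
  obtain ⟨x, hx⟩ := exists_fixedPoint_of_contDiff φ.contMDiff.contDiff hφ1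
  have hx1 : ‖x‖ ≤ 1 := hx ▸ hφ1 x
  have h1 : dist (φ x) (f (radialProj x)) < δ := (hφ x).2
  rw [hx, radialProj_of_norm_le_one hx1, dist_comm, dist_eq_norm] at h1
  exact absurd (hmin (by simpa using hx1 : x ∈ closedBall (0 : E) 1)) (not_le.2 h1)

theorem holonomy_flow_surjectivity (d : ℕ) (hd : 1 ≤ d)
    (v : EuclideanSpace ℝ (Fin d)) (hv : ‖v‖ = 1)
    (z : EuclideanSpace ℝ (Fin d)) (ε a : ℝ) (hε : 0 < ε) (ha : 0 < a)
    (H : ℝ × EuclideanSpace ℝ (Fin d) → EuclideanSpace ℝ (Fin d))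
    (hHcont : ContinuousOn H (Icc (-a) a ×ˢ closedBall z ε))
    (hHclose : ∀ p ∈ Icc (-a) a ×ˢ closedBall z ε, ‖H p - (p.2 + p.1 • v)‖ ≤ ε / 2) :
    ∀ y ∈ closedBall z (ε / 2), ∀ t ∈ Icc (-a) a,
      y + t • v ∈ H '' (Icc (-a) a ×ˢ closedBall z ε) := by
  intro y hy t ht
  have hmem : ∀ x ∈ closedBall (0 : EuclideanSpace ℝ (Fin d)) 1,
      (t, z + ε • x) ∈ Icc (-a) a ×ˢ closedBall z ε := fun x hx => by
    refine ⟨ht, ?_⟩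
    rw [mem_closedBall_zero_iff] at hx
    rw [mem_closedBall, dist_self_add_left, norm_smul, Real.norm_of_nonneg hε.le]
    exact mul_le_of_le_one_right hε.le hx
  obtain ⟨x, hx, hfix⟩ := exists_fixedPoint_of_continuousOn_closedBall_s8
    (f := fun x => x + ε⁻¹ • (y + t • v - H (t, z + ε • x)))
    (by
      have := hHcont.comp (f := fun x => (t, z + ε • x)) (by fun_prop) hmem
      exact continuousOn_id.add ((continuousOn_const.sub this).const_smul ε⁻¹))
    (fun x hx => by
      have h1 := hHclose _ (hmem x hx)
      have h2 : ‖y - z‖ ≤ ε / 2 := by rwa [mem_closedBall, dist_eq_norm] at hy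
      have h3 : x + ε⁻¹ • (y + t • v - H (t, z + ε • x))
          = ε⁻¹ • ((y - z) - (H (t, z + ε • x) - (z + ε • x + t • v))) := by
        have : x = ε⁻¹ • (ε • x) := by rw [inv_smul_smul₀ hε.ne']
        nth_rewrite 1 [this]
        module
      beta_reduce
      rw [mem_closedBall_zero_iff, h3, norm_smul, norm_inv, Real.norm_of_nonneg hε.le,
        inv_mul_le_iff₀ hε, mul_one]
      exact (norm_sub_le _ _).trans (by linarith))
  refine ⟨(t, z + ε • x), hmem x hx, ?_⟩
  have h1 : ε⁻¹ • (y + t • v - H (t, z + ε • x)) = 0 := by simpa using hfix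
  exact (sub_eq_zero.1 ((smul_eq_zero.1 h1).resolve_left (inv_ne_zero hε.ne'))).symm
end

section
/- For every integer d ≥ 2 there exists a constant C > 0, depending only on d, such that for every z ∈ ℝ^d, every r > 0 and every v ∈ ℝ^d, there exists a C^∞ vector field X : ℝ^d → ℝ^d with: (i) X(x) = v for every x ∈ closedBall(z, 2r); (ii) X(x) = 0 for every x outside ball(z, 3r); (iii) X is divergence free, i.e. the trace of fderiv ℝ X x (as a linear endomorphism of ℝ^d) is 0 for every x; and (iv) ‖fderiv ℝ X x‖ ≤ C·‖v‖/r for every x. -/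
open Metric Set

section DivergenceFreeCutoff

variable {E : Type*} [NormedAddCommGroup E] [NormedSpace ℝ E]

/-- The operator-valued field `y ↦ (v ↦ φ(y) v + c (Dφ(y)y • v - Dφ(y)v • y))`. For `c = 1/(d-1)`
its values at `v` are the divergence of the antisymmetric tensor `c φ(y) (v ⊗ y - y ⊗ v)`. -/
noncomputable def divFreeCutoff (φ : E → ℝ) (c : ℝ) (y : E) : E →L[ℝ] E :=
  φ y • ContinuousLinearMap.id ℝ E +
    c • (fderiv ℝ φ y y • ContinuousLinearMap.id ℝ E - (fderiv ℝ φ y).smulRight y)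

variable {φ : E → ℝ} {c : ℝ}

lemma divFreeCutoff_apply (y v : E) :
    divFreeCutoff φ c y v = φ y • v + c • (fderiv ℝ φ y y • v - fderiv ℝ φ y v • y) := by
  simp [divFreeCutoff]

lemma divFreeCutoff_of_fderiv_eq_zero {y : E} (h : fderiv ℝ φ y = 0) :
    divFreeCutoff φ c y = φ y • ContinuousLinearMap.id ℝ E := by
  ext v
  simp [divFreeCutoff, h]

lemma contDiff_divFreeCutoff (hφ : ContDiff ℝ (⊤ : ℕ∞) φ) :
    ContDiff ℝ (⊤ : ℕ∞) (divFreeCutoff φ c) := by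
  have h : ContDiff ℝ (⊤ : ℕ∞) (fderiv ℝ φ) := hφ.fderiv_right (by simp)
  unfold divFreeCutoff
  fun_prop

lemma hasCompactSupport_divFreeCutoff (hφ : HasCompactSupport φ) :
    HasCompactSupport (divFreeCutoff φ c) := by
  refine hφ.mono' fun y hy ↦ ?_
  by_contra hn
  have h0 : φ y = 0 := image_eq_zero_of_notMem_tsupport hn
  have h1 : fderiv ℝ φ y = 0 := by
    by_contra h
    exact hn (support_fderiv_subset ℝ h)
  exact hy (by simp [divFreeCutoff_of_fderiv_eq_zero h1, h0])

lemma trace_fderiv_divFreeCutoff [FiniteDimensional ℝ E] (hφ : ContDiff ℝ (⊤ : ℕ∞) φ)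
    (hc : c * (Module.finrank ℝ E - 1) = 1) (v y : E) :
    LinearMap.trace ℝ E (fderiv ℝ (fun y ↦ divFreeCutoff φ c y v) y : E →ₗ[ℝ] E) = 0 := by
  have h : ContDiff ℝ (⊤ : ℕ∞) (fderiv ℝ φ) := hφ.fderiv_right (by simp)
  have hL : HasFDerivAt φ (fderiv ℝ φ y) y := (hφ.differentiable (by simp) y).hasFDerivAt
  have hB : HasFDerivAt (fderiv ℝ φ) (fderiv ℝ (fderiv ℝ φ) y) y :=
    (h.differentiable (by simp) y).hasFDerivAt
  have hsymm : fderiv ℝ (fderiv ℝ φ) y v y = fderiv ℝ (fderiv ℝ φ) y y v :=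
    (hφ.contDiffAt.isSymmSndFDerivAt
      (by simpa using WithTop.coe_le_coe.2 (le_top : (2 : ℕ∞) ≤ ⊤))) v y
  have hD := (hL.smul_const v).add ((((hB.clm_apply (hasFDerivAt_id y)).smul_const v).sub
    ((hB.clm_apply (hasFDerivAt_const v y)).smul (hasFDerivAt_id y))).const_smul c)
  have hfun : (fun y ↦ divFreeCutoff φ c y v) =
      fun y ↦ φ y • v + c • (fderiv ℝ φ y y • v - fderiv ℝ φ y v • y) :=
    funext fun y ↦ divFreeCutoff_apply y v
  have hT : (fderiv ℝ (fun y ↦ divFreeCutoff φ c y v) y : E →ₗ[ℝ] E) =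
      (fderiv ℝ φ y : E →ₗ[ℝ] ℝ).smulRight v +
        c • (((fderiv ℝ (fderiv ℝ φ) y).flip y + fderiv ℝ φ y : E →ₗ[ℝ] ℝ).smulRight v -
          ((fderiv ℝ (fderiv ℝ φ) y).flip v : E →ₗ[ℝ] ℝ).smulRight y -
          fderiv ℝ φ y v • LinearMap.id) := by
    rw [hfun]
    refine (congrArg _ hD.fderiv).trans ?_
    ext w
    simp
    module
  rw [hT]
  simp only [map_add, map_sub, map_smul, LinearMap.trace_smulRight, LinearMap.trace_id,
    LinearMap.add_apply, ContinuousLinearMap.coe_coe, ContinuousLinearMap.flip_apply, hsymm,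
    smul_eq_mul]
  linear_combination (-(fderiv ℝ φ y v)) * hc

lemma exists_bound_fderiv_divFreeCutoff (hφ : ContDiff ℝ (⊤ : ℕ∞) φ) (hs : HasCompactSupport φ) :
    ∃ C : ℝ, 0 < C ∧ ∀ v y : E, ‖fderiv ℝ (fun y ↦ divFreeCutoff φ c y v) y‖ ≤ C * ‖v‖ := by
  have hG : ContDiff ℝ (⊤ : ℕ∞) (divFreeCutoff φ c) := contDiff_divFreeCutoff hφ
  obtain ⟨C, hC⟩ := (hG.continuous_fderiv (by simp)).bounded_above_of_compact_support
    ((hasCompactSupport_divFreeCutoff hs).fderiv ℝ)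
  refine ⟨max C 1, by positivity, fun v y ↦ ?_⟩
  have hd : HasFDerivAt (fun y ↦ divFreeCutoff φ c y v)
      ((fderiv ℝ (divFreeCutoff φ c) y).flip v) y := by
    simpa using ((hG.differentiable (by simp) y).hasFDerivAt).clm_apply (hasFDerivAt_const v y)
  rw [hd.fderiv]
  calc _ ≤ ‖(fderiv ℝ (divFreeCutoff φ c) y).flip‖ * ‖v‖ := ContinuousLinearMap.le_opNorm _ _
    _ ≤ max C 1 * ‖v‖ := by
      rw [ContinuousLinearMap.opNorm_flip]
      gcongr
      exact (hC y).trans (le_max_left _ _)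

end DivergenceFreeCutoff

theorem divergence_free_bump_vector_field (d : ℕ) (hd : 2 ≤ d) :
    ∃ C : ℝ, 0 < C ∧
      ∀ (z : EuclideanSpace ℝ (Fin d)) (r : ℝ), 0 < r →
      ∀ v : EuclideanSpace ℝ (Fin d),
        ∃ X : EuclideanSpace ℝ (Fin d) → EuclideanSpace ℝ (Fin d),
          ContDiff ℝ (⊤ : ℕ∞) X ∧
          (∀ x ∈ closedBall z (2 * r), X x = v) ∧
          (∀ x, x ∉ ball z (3 * r) → X x = 0) ∧
          (∀ x, LinearMap.trace ℝ (EuclideanSpace ℝ (Fin d))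
            (fderiv ℝ X x : EuclideanSpace ℝ (Fin d) →ₗ[ℝ] EuclideanSpace ℝ (Fin d)) = 0) ∧
          (∀ x, ‖fderiv ℝ X x‖ ≤ C * ‖v‖ / r) := by
  let φ : ContDiffBump (0 : EuclideanSpace ℝ (Fin d)) := ⟨2, 3, by norm_num, by norm_num⟩
  have hφ : ContDiff ℝ (⊤ : ℕ∞) φ := φ.contDiff
  have hd2 : (2 : ℝ) ≤ d := by exact_mod_cast hd
  let c : ℝ := ((d : ℝ) - 1)⁻¹
  have hc : c * (Module.finrank ℝ (EuclideanSpace ℝ (Fin d)) - 1) = 1 := by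
    rw [finrank_euclideanSpace_fin]
    exact inv_mul_cancel₀ (by linarith)
  obtain ⟨C, hC0, hC⟩ := exists_bound_fderiv_divFreeCutoff (c := c) hφ φ.hasCompactSupport
  refine ⟨C, hC0, fun z r hr v ↦ ?_⟩
  have hY : ContDiff ℝ (⊤ : ℕ∞) fun y ↦ divFreeCutoff φ c y v :=
    (contDiff_divFreeCutoff hφ).clm_apply contDiff_const
  have hnorm (x : EuclideanSpace ℝ (Fin d)) : ‖r⁻¹ • (x - z)‖ = dist x z / r := by
    rw [norm_smul, norm_inv, Real.norm_of_nonneg hr.le, dist_eq_norm, inv_mul_eq_div]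
  have hX (x : EuclideanSpace ℝ (Fin d)) :
      fderiv ℝ (fun x ↦ divFreeCutoff φ c (r⁻¹ • (x - z)) v) x =
        r⁻¹ • fderiv ℝ (fun y ↦ divFreeCutoff φ c y v) (r⁻¹ • (x - z)) := by
    have h := (hY.differentiable (by simp) (r⁻¹ • (x - z))).hasFDerivAt.comp x
      (((hasFDerivAt_id x).sub_const z).const_smul r⁻¹)
    refine h.fderiv.trans ?_
    ext1 w
    simp
  refine ⟨fun x ↦ divFreeCutoff φ c (r⁻¹ • (x - z)) v, hY.comp (by fun_prop),
    fun x hx ↦ ?_, fun x hx ↦ ?_, fun x ↦ ?_, fun x ↦ ?_⟩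
  · have h1 : φ (r⁻¹ • (x - z)) = 1 := φ.one_of_mem_closedBall <| by
      rw [mem_closedBall_zero_iff, hnorm]
      exact (div_le_iff₀ hr).2 hx
    have h2 : IsLocalMax φ (r⁻¹ • (x - z)) := .of_forall fun y ↦ h1 ▸ φ.le_one
    simp [divFreeCutoff_of_fderiv_eq_zero h2.fderiv_eq_zero, h1]
  · have h1 : φ (r⁻¹ • (x - z)) = 0 := φ.zero_of_le_dist <| by
      rw [dist_zero_right, hnorm]
      exact (le_div_iff₀ hr).2 (not_lt.1 hx)
    have h2 : IsLocalMin φ (r⁻¹ • (x - z)) := .of_forall fun y ↦ h1 ▸ φ.nonneg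
    simp [divFreeCutoff_of_fderiv_eq_zero h2.fderiv_eq_zero, h1]
  · rw [hX, ContinuousLinearMap.toLinearMap_smul, map_smul, trace_fderiv_divFreeCutoff hφ hc,
      smul_zero]
  · rw [hX, norm_smul, norm_inv, Real.norm_of_nonneg hr.le, inv_mul_eq_div]
    gcongr
    exact hC v _
end
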